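/- arXiv:2408.14995 — 10 statements merged into one kernel-verified Lean document; each statement's English description precedes it below -/
import Mathlib

section
/- Let d ≥ 1, let M ⊆ ℝ^d be star-shaped with center c, let v ∈ ℝ^d and t ∈ ℝ with t < ⟪v,c⟫, and let L = {x ∈ M | ⟪v,x⟫ = t} be the level set. Then L is a strong deformation retract of the sublevel set M_{v,t}: the map H : [0,1] × M_{v,t} → ℝ^d defined by H(s,x) = x + s·((t − ⟪v,x⟫)/(⟪v,c⟫ − ⟪v,x⟫))·(c − x) is continuous, takes values in M_{v,t}, satisfies H(0,x) = x for all x, H(1,x) ∈ L for all x ∈ M_{v,t}, and H(s,x) = x for all s ∈ [0,1] and x ∈ L. In particular the inclusion L ↪ M_{v,t} is a homotopy equivalence of topological subspaces. -/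
/-- For a star-shaped set `M ⊆ ℝ^d` with center `c` and `t < ⟪v,c⟫`,
the level set `L = {x ∈ M | ⟪v,x⟫ = t}` is a strong deformation retract of the sublevel
set `M_{v,t}`, via the explicit homotopy
`H(s,x) = x + s·((t − ⟪v,x⟫)/(⟪v,c⟫ − ⟪v,x⟫))·(c − x)`.
In particular the inclusion `L ↪ M_{v,t}` is a homotopy equivalence. -/
theorem level_set_deformation_retract_of_sublevel
    (d : ℕ) (hd : 1 ≤ d)
    (M : Set (EuclideanSpace ℝ (Fin d))) (c : EuclideanSpace ℝ (Fin d))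
    (hcM : c ∈ M) (hstar : StarConvex ℝ c M)
    (v : EuclideanSpace ℝ (Fin d)) (t : ℝ)
    (ht : t < (inner ℝ v c : ℝ))
    (S : Set (EuclideanSpace ℝ (Fin d)))
    (hS : S = {x ∈ M | (inner ℝ v x : ℝ) ≤ t})
    (L : Set (EuclideanSpace ℝ (Fin d)))
    (hL : L = {x ∈ M | (inner ℝ v x : ℝ) = t})
    (H : ℝ → EuclideanSpace ℝ (Fin d) → EuclideanSpace ℝ (Fin d))
    (hH : ∀ s x, H s x =
      x + (s * ((t - (inner ℝ v x : ℝ)) / ((inner ℝ v c : ℝ) - (inner ℝ v x : ℝ)))) • (c - x)) :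
    ContinuousOn (fun p : ℝ × EuclideanSpace ℝ (Fin d) => H p.1 p.2)
      (Set.Icc (0 : ℝ) 1 ×ˢ S) ∧
    (∀ s ∈ Set.Icc (0 : ℝ) 1, ∀ x ∈ S, H s x ∈ S) ∧
    (∀ x ∈ S, H 0 x = x) ∧
    (∀ x ∈ S, H 1 x ∈ L) ∧
    (∀ s ∈ Set.Icc (0 : ℝ) 1, ∀ x ∈ L, H s x = x) ∧
    ∃ e : ContinuousMap.HomotopyEquiv (↥L) (↥S),
      ∀ x : ↥L, (e.toFun x : EuclideanSpace ℝ (Fin d)) = (x : EuclideanSpace ℝ (Fin d)) := by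
  have hpos : ∀ x ∈ S, 0 < (inner ℝ v c : ℝ) - inner ℝ v x := by
    intro x hx
    rw [hS] at hx
    have := hx.2
    linarith
  have hLS : ∀ x ∈ L, x ∈ S := by
    intro x hx
    rw [hL] at hx
    rw [hS]
    exact ⟨hx.1, hx.2.le⟩
  have hcont : ContinuousOn (fun p : ℝ × EuclideanSpace ℝ (Fin d) => H p.1 p.2)
      (Set.Icc (0 : ℝ) 1 ×ˢ S) := by
    simp only [hH]
    have hdiv : ContinuousOn (fun p : ℝ × EuclideanSpace ℝ (Fin d) =>
        (t - (inner ℝ v p.2 : ℝ)) / ((inner ℝ v c : ℝ) - (inner ℝ v p.2 : ℝ)))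
        (Set.Icc (0 : ℝ) 1 ×ˢ S) := by
      apply ContinuousOn.div
      · fun_prop
      · fun_prop
      · intro p hp
        exact (hpos p.2 hp.2).ne'
    exact continuousOn_snd.add ((continuousOn_fst.mul hdiv).smul
      (continuousOn_const.sub continuousOn_snd))
  have hM : ∀ s ∈ Set.Icc (0 : ℝ) 1, ∀ x ∈ S, H s x ∈ M := by
    intro s hs x hx
    have hp := hpos x hx
    rw [hS] at hx
    have hx2 : (inner ℝ v x : ℝ) ≤ t := hx.2
    set r := (t - (inner ℝ v x : ℝ)) / ((inner ℝ v c : ℝ) - (inner ℝ v x : ℝ)) with hr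
    have hr0 : 0 ≤ r := div_nonneg (by linarith) hp.le
    have hr1 : r ≤ 1 := by
      rw [hr, div_le_one hp]
      linarith
    have h0 : 0 ≤ s * r := mul_nonneg hs.1 hr0
    have h1 : s * r ≤ 1 := mul_le_one₀ hs.2 hr0 hr1
    have := hstar hx.1 h0 (sub_nonneg.2 h1) (by ring)
    rw [hH, ← hr]
    convert this using 1
    module
  have hin : ∀ s, ∀ x ∈ S, (inner ℝ v (H s x) : ℝ) = inner ℝ v x + s * (t - inner ℝ v x) := by
    intro s x hx
    have hp := (hpos x hx).ne'
    rw [hH, inner_add_right, inner_smul_right, inner_sub_right]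
    field_simp
  have hHS : ∀ s ∈ Set.Icc (0 : ℝ) 1, ∀ x ∈ S, H s x ∈ S := by
    intro s hs x hx
    have h1 := hM s hs x hx
    have h2 := hin s x hx
    rw [hS] at hx ⊢
    refine ⟨h1, ?_⟩
    have hx2 : (inner ℝ v x : ℝ) ≤ t := hx.2
    rw [h2]
    nlinarith [hs.1, hs.2]
  have hH0 : ∀ x, H 0 x = x := by
    intro x
    simp [hH]
  have hH1 : ∀ x ∈ S, H 1 x ∈ L := by
    intro x hx
    rw [hL]
    refine ⟨hM 1 (by simp) x hx, ?_⟩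
    rw [hin 1 x hx]
    ring
  have hHL : ∀ s, ∀ x ∈ L, H s x = x := by
    intro s x hx
    rw [hL] at hx
    simp [hH, hx.2]
  refine ⟨hcont, hHS, fun x _ => hH0 x, hH1, fun s _ => hHL s, ?_⟩
  have hc1 : Continuous (fun x : S => H 1 x) :=
    hcont.comp_continuous (f := fun x : S => ((1 : ℝ), (x : EuclideanSpace ℝ (Fin d))))
      (by fun_prop) (fun x => ⟨by simp, x.2⟩)
  have hc2 : Continuous (fun p : unitInterval × S => H p.1 p.2) :=
    hcont.comp_continuous
      (f := fun p : unitInterval × S => ((p.1 : ℝ), (p.2 : EuclideanSpace ℝ (Fin d))))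
      (by fun_prop) (fun p => ⟨p.1.2, p.2.2⟩)
  let i : C(L, S) := ⟨fun x => ⟨x, hLS x x.2⟩, by fun_prop⟩
  let r : C(S, L) := ⟨fun x => ⟨H 1 x, hH1 x x.2⟩, hc1.subtype_mk _⟩
  have hri : r.comp i = ContinuousMap.id L := by
    ext1 x
    exact Subtype.ext (hHL 1 x x.2)
  let F : ContinuousMap.Homotopy (ContinuousMap.id S) (i.comp r) :=
    { toFun := fun p => ⟨H p.1 p.2, hHS p.1 p.1.2 p.2 p.2.2⟩
      continuous_toFun := hc2.subtype_mk _
      map_zero_left := fun x => Subtype.ext (hH0 x)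
      map_one_left := fun x => Subtype.ext rfl }
  exact ⟨⟨i, r, hri ▸ ContinuousMap.Homotopic.refl _, ⟨F.symm⟩⟩, fun x => rfl⟩
end

section
/- Let M ⊆ ℝ² be star-shaped with center c, let v ∈ ℝ² and t ∈ ℝ with t < ⟪v,c⟫. Then for every x in the sublevel set M_{v,t}, the connected component of x in M_{v,t} (connectedComponentIn M_{v,t} x), viewed as a topological subspace of ℝ², is path-connected and simply connected (its fundamental group is trivial). -/
theorem aux_homotopic {E X : Type*} [TopologicalSpace X] [NormedAddCommGroup E] [NormedSpace ℝ E]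
    {C : Set E} (f g : C(X, C)) (h : ∀ x, segment ℝ (f x : E) (g x) ⊆ C) :
    ContinuousMap.Homotopic f g := by
  refine ⟨{ toFun := fun p => ⟨AffineMap.lineMap (f p.2 : E) (g p.2 : E) (p.1 : ℝ), ?_⟩
            continuous_toFun := ?_
            map_zero_left := ?_
            map_one_left := ?_ }⟩
  · apply h p.2
    rw [segment_eq_image_lineMap]
    exact ⟨p.1, p.1.2, rfl⟩
  · apply Continuous.subtype_mk
    simp only [AffineMap.lineMap_apply_module]
    fun_prop
  · intro x; simp
  · intro x; simp

theorem aux_line (v : EuclideanSpace ℝ (Fin 2)) (hv : v ≠ 0) (t : ℝ)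
    (D : Set (EuclideanSpace ℝ (Fin 2))) (hD : IsPreconnected D)
    (hL : ∀ y ∈ D, (inner ℝ v y : ℝ) = t) : Convex ℝ D := by
  have hin : ∀ y : EuclideanSpace ℝ (Fin 2), (inner ℝ v y : ℝ) = v 0 * y 0 + v 1 * y 1 := by
    intro y
    simp [PiLp.inner_apply, Fin.sum_univ_two, mul_comm]
  have hn : 0 < v 0 ^ 2 + v 1 ^ 2 := by
    by_contra hcon
    apply hv
    have h0 : v 0 = 0 := by nlinarith [sq_nonneg (v 0), sq_nonneg (v 1)]
    have h1 : v 1 = 0 := by nlinarith [sq_nonneg (v 0), sq_nonneg (v 1)]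
    ext i; fin_cases i <;> simp [h0, h1]
  let φ : EuclideanSpace ℝ (Fin 2) → ℝ := fun y => v 0 * y 1 - v 1 * y 0
  have hφ : Continuous φ := by fun_prop
  have hcv : Convex ℝ (φ '' D) := (hD.image φ hφ.continuousOn).ordConnected.convex
  intro a ha b hb
  intro α β hα hβ hαβ
  obtain ⟨q, hq, hqe⟩ := hcv ⟨a, ha, rfl⟩ ⟨b, hb, rfl⟩ hα hβ hαβ
  have e1 := hL a ha
  have e2 := hL b hb
  have e3 := hL q hq
  rw [hin] at e1 e2 e3
  simp only [φ, smul_eq_mul] at hqe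
  set p := α • a + β • b with hp
  have hp0 : p 0 = α * a 0 + β * b 0 := by simp [hp]
  have hp1 : p 1 = α * a 1 + β * b 1 := by simp [hp]
  have k1 : v 0 * (p 0 - q 0) + v 1 * (p 1 - q 1) = 0 := by
    rw [hp0, hp1]; linear_combination α * e1 + β * e2 - e3 + t * hαβ
  have k2 : v 0 * (p 1 - q 1) - v 1 * (p 0 - q 0) = 0 := by
    rw [hp0, hp1]; linear_combination -hqe
  have m0 : p 0 - q 0 = 0 := by
    have : (v 0 ^ 2 + v 1 ^ 2) * (p 0 - q 0) = 0 := by linear_combination v 0 * k1 - v 1 * k2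
    exact (mul_eq_zero.mp this).resolve_left hn.ne'
  have m1 : p 1 - q 1 = 0 := by
    have : (v 0 ^ 2 + v 1 ^ 2) * (p 1 - q 1) = 0 := by linear_combination v 1 * k1 + v 0 * k2
    exact (mul_eq_zero.mp this).resolve_left hn.ne'
  have : p = q := by
    ext i; fin_cases i
    · exact sub_eq_zero.mp m0
    · exact sub_eq_zero.mp m1
  rw [this]; exact hq

/-- For a star-shaped set `M ⊆ ℝ²` with center `c` and `t < ⟪v,c⟫`,
every connected component of the sublevel set `M_{v,t}` is path-connected and
simply connected (its fundamental group is trivial). -/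
theorem component_of_sublevel_simply_connected
    (M : Set (EuclideanSpace ℝ (Fin 2))) (c : EuclideanSpace ℝ (Fin 2))
    (hcM : c ∈ M) (hstar : StarConvex ℝ c M)
    (v : EuclideanSpace ℝ (Fin 2)) (t : ℝ)
    (ht : t < (inner ℝ v c : ℝ))
    (x : EuclideanSpace ℝ (Fin 2))
    (hx : x ∈ {y ∈ M | (inner ℝ v y : ℝ) ≤ t}) :
    IsPathConnected (connectedComponentIn {y ∈ M | (inner ℝ v y : ℝ) ≤ t} x) ∧
    SimplyConnectedSpace ↥(connectedComponentIn {y ∈ M | (inner ℝ v y : ℝ) ≤ t} x) := by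
  set S := {y ∈ M | (inner ℝ v y : ℝ) ≤ t} with hS
  set C := connectedComponentIn S x with hC
  have hCS : C ⊆ S := connectedComponentIn_subset S x
  have hxC : x ∈ C := mem_connectedComponentIn hx
  have hCc : IsPreconnected C := isPreconnected_connectedComponentIn
  have hv : v ≠ 0 := by
    rintro rfl
    have := hx.2
    simp at this ht
    linarith
  let s : EuclideanSpace ℝ (Fin 2) → ℝ := fun y => (inner ℝ v c - t) / (inner ℝ v c - inner ℝ v y)
  let r : EuclideanSpace ℝ (Fin 2) → EuclideanSpace ℝ (Fin 2) := fun y => c + s y • (y - c)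
  have hpos : ∀ y ∈ S, (0:ℝ) < inner ℝ v c - inner ℝ v y := fun y hy => by
    have := hy.2
    linarith
  have hrL : ∀ y ∈ S, (inner ℝ v (r y) : ℝ) = t := by
    intro y hy
    have := (hpos y hy).ne'
    simp only [r, s, inner_add_right, inner_smul_right, inner_sub_right]
    field_simp
    ring
  have hrcont : ContinuousOn r S := by
    apply ContinuousOn.add continuousOn_const
    apply ContinuousOn.fun_smul
    · apply ContinuousOn.div continuousOn_const
      · fun_prop
      · exact fun y hy => (hpos y hy).ne'
    · fun_prop
  have hrseg : ∀ y ∈ S, r y ∈ segment ℝ c y := by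
    intro y hy
    rw [segment_eq_image']
    refine ⟨s y, ⟨?_, ?_⟩, rfl⟩
    · exact div_nonneg (by linarith) (hpos y hy).le
    · rw [div_le_one (hpos y hy)]
      linarith [hy.2]
  have hhalf : Convex ℝ {y : EuclideanSpace ℝ (Fin 2) | (inner ℝ v y : ℝ) ≤ t} :=
    convex_halfSpace_le (innerₛₗ ℝ v).isLinear t
  have hsegS : ∀ y ∈ S, segment ℝ y (r y) ⊆ S := by
    intro y hy z hz
    refine ⟨?_, hhalf.segment_subset hy.2 (hrL y hy).le hz⟩
    apply hstar.segment_subset hy.1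
    exact (convex_segment c y).segment_subset (right_mem_segment ℝ c y) (hrseg y hy) hz
  have hsegC : ∀ y ∈ C, segment ℝ y (r y) ⊆ C := by
    intro y hy
    rw [hC, connectedComponentIn_eq hy]
    exact (convex_segment y (r y)).isPreconnected.subset_connectedComponentIn
      (left_mem_segment ℝ _ _) (hsegS y (hCS hy))
  have hrC : ∀ y ∈ C, r y ∈ C := fun y hy => hsegC y hy (right_mem_segment ℝ _ _)
  have hconv : Convex ℝ (r '' C) := by
    apply aux_line v hv t _ (hCc.image r (hrcont.mono hCS))
    rintro _ ⟨y, hy, rfl⟩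
    exact hrL y (hCS hy)
  have hsub : r '' C ⊆ C := by
    rintro _ ⟨y, hy, rfl⟩
    exact hrC y hy
  let R : C(C, C) := ⟨fun y => ⟨r y, hrC y y.2⟩,
    ((hrcont.mono hCS).domRestrict).subtype_mk _⟩
  have h1 : ContinuousMap.Homotopic (ContinuousMap.id C) R :=
    aux_homotopic _ _ fun y => hsegC y y.2
  have h2 : ContinuousMap.Homotopic R (ContinuousMap.const C ⟨r x, hrC x hxC⟩) :=
    aux_homotopic _ _ fun y =>
      (hconv.segment_subset ⟨y, y.2, rfl⟩ ⟨x, hxC, rfl⟩).trans hsub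
  have : ContractibleSpace C := (contractible_iff_id_nullhomotopic C).2 ⟨_, h1.trans h2⟩
  exact ⟨isPathConnected_iff_pathConnectedSpace.2 inferInstance, inferInstance⟩
end

section
/- Let d ≥ 1, let M ⊆ ℝ^d be star-shaped with center c, let u ∈ ℝ^d be a unit vector, a ∈ ℝ, and let σ ⊆ ℝ^d be a set with ⟪u,x⟫ = a for every x ∈ σ and with ⟪u,c⟫ ≤ a. Define the sector M^σ = M ∩ convexHull ℝ ({c} ∪ σ). Then: (i) for every t < ⟪u,c⟫ the sublevel set M^σ_{u,t} = {x ∈ M^σ | ⟪u,x⟫ ≤ t} is empty; and (ii) for every t ≥ ⟪u,c⟫ the set M^σ_{u,t} is star-shaped with center c, hence nonempty and path-connected. -/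
/-- Let `M ⊆ ℝ^d` be star-shaped with center `c`, `u` a unit vector,
`σ` a set lying in the hyperplane `⟪u,·⟫ = a` with `⟪u,c⟫ ≤ a`, and let
`M^σ = M ∩ convexHull ℝ ({c} ∪ σ)` be the corresponding sector. Then the sublevel
sets `M^σ_{u,t}` are empty for `t < ⟪u,c⟫`, and star-shaped with center `c`
(hence nonempty and path-connected) for `t ≥ ⟪u,c⟫`. -/
theorem sector_sublevel_empty_or_starShaped
    (d : ℕ) (hd : 1 ≤ d)
    (M : Set (EuclideanSpace ℝ (Fin d))) (c : EuclideanSpace ℝ (Fin d))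
    (hcM : c ∈ M) (hstar : StarConvex ℝ c M)
    (u : EuclideanSpace ℝ (Fin d)) (hu : ‖u‖ = 1) (a : ℝ)
    (σ : Set (EuclideanSpace ℝ (Fin d)))
    (hσ : ∀ x ∈ σ, (inner ℝ u x : ℝ) = a)
    (hca : (inner ℝ u c : ℝ) ≤ a) :
    (∀ t : ℝ, t < (inner ℝ u c : ℝ) →
      {x ∈ M ∩ convexHull ℝ ({c} ∪ σ) | (inner ℝ u x : ℝ) ≤ t} = ∅) ∧
    (∀ t : ℝ, (inner ℝ u c : ℝ) ≤ t →
      c ∈ {x ∈ M ∩ convexHull ℝ ({c} ∪ σ) | (inner ℝ u x : ℝ) ≤ t} ∧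
      StarConvex ℝ c {x ∈ M ∩ convexHull ℝ ({c} ∪ σ) | (inner ℝ u x : ℝ) ≤ t} ∧
      {x ∈ M ∩ convexHull ℝ ({c} ∪ σ) | (inner ℝ u x : ℝ) ≤ t}.Nonempty ∧
      IsPathConnected {x ∈ M ∩ convexHull ℝ ({c} ∪ σ) | (inner ℝ u x : ℝ) ≤ t}) := by
  have hlin : IsLinearMap ℝ (fun x : EuclideanSpace ℝ (Fin d) => (inner ℝ u x : ℝ)) :=
    ⟨fun x y => inner_add_right u x y, fun r x => real_inner_smul_right u x r⟩
  refine ⟨fun t ht => ?_, fun t ht => ?_⟩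
  · rw [Set.eq_empty_iff_forall_notMem]
    rintro x ⟨⟨_, hx⟩, hxt⟩
    have hsub : convexHull ℝ ({c} ∪ σ) ⊆ {x | (inner ℝ u c : ℝ) ≤ (inner ℝ u x : ℝ)} := by
      refine convexHull_min ?_ (convex_halfSpace_ge hlin _)
      rintro y (hy | hy)
      · rw [Set.mem_singleton_iff] at hy
        subst hy
        exact le_refl (inner ℝ u y : ℝ)
      · exact hca.trans (hσ y hy).ge
    exact absurd (lt_of_le_of_lt ((hsub hx).trans hxt) ht) (lt_irrefl _)
  · have hcH : c ∈ convexHull ℝ ({c} ∪ σ) := subset_convexHull ℝ _ (Or.inl rfl)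
    have hc : c ∈ {x ∈ M ∩ convexHull ℝ ({c} ∪ σ) | (inner ℝ u x : ℝ) ≤ t} :=
      ⟨⟨hcM, hcH⟩, ht⟩
    have hs : StarConvex ℝ c {x ∈ M ∩ convexHull ℝ ({c} ∪ σ) | (inner ℝ u x : ℝ) ≤ t} :=
      (hstar.inter ((convex_convexHull ℝ _).starConvex hcH)).inter
        ((convex_halfSpace_le hlin t).starConvex ht)
    exact ⟨hc, hs, ⟨c, hc⟩, hs.isPathConnected hc⟩
end

section
/- Let d ≥ 1, let M ⊆ ℝ^d be compact and star-shaped with center c, let v ∈ ℝ^d and t ∈ ℝ with t < ⟪v,c⟫, and set (∂M)_{v,t} = frontier M ∩ {x | ⟪v,x⟫ ≤ t}. Then the inclusion (∂M)_{v,t} ⊆ M_{v,t} induces a bijection on connected components; explicitly: (i) for every x ∈ M_{v,t}, the connected component connectedComponentIn M_{v,t} x meets (∂M)_{v,t}; and (ii) for all x, y ∈ (∂M)_{v,t}, y ∈ connectedComponentIn (∂M)_{v,t} x if and only if y ∈ connectedComponentIn M_{v,t} x. -/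
open Set Topology

section Helpers
variable {E : Type*} [NormedAddCommGroup E] [InnerProductSpace ℝ E]

lemma ray_mem_interior {M : Set E} {c : E} (hstar : StarConvex ℝ c M) {z : E}
    (hz : z ∈ interior M) {k : ℝ} (hk : 0 < k) (hk1 : k ≤ 1) :
    c + k • (z - c) ∈ interior M := by
  have hop : IsOpen (AffineMap.homothety c k '' interior M) :=
    AffineMap.homothety_isOpenMap c k hk.ne' _ isOpen_interior
  refine interior_maximal ?_ hop ⟨z, hz, ?_⟩
  · rintro _ ⟨w, hw, rfl⟩
    have := hstar.add_smul_sub_mem (interior_subset hw) hk.le hk1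
    simpa [AffineMap.homothety_apply, add_comm] using this
  · simp [AffineMap.homothety_apply, add_comm]

lemma inner_ray (v c a : E) (k : ℝ) :
    (inner ℝ v (c + k • (a - c)) : ℝ) = inner ℝ v c + k * (inner ℝ v a - inner ℝ v c) := by
  rw [inner_add_right, inner_smul_right, inner_sub_right]

/-- Radial segments between frontier points stay in the sublevel frontier. -/
lemma seg_subset {M : Set E} (hMc : IsClosed M) {c : E} (hstar : StarConvex ℝ c M)
    {v : E} {t : ℝ} {a : E} (ha : a ∈ frontier M ∩ {x | (inner ℝ v x : ℝ) ≤ t})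
    {r : ℝ} (hr : 0 < r)
    (hb : c + r • (a - c) ∈ frontier M ∩ {x | (inner ℝ v x : ℝ) ≤ t})
    {ρ : ℝ} (hρ : ρ ∈ Icc r 1) :
    c + ρ • (a - c) ∈ frontier M ∩ {x | (inner ℝ v x : ℝ) ≤ t} := by
  rw [hMc.frontier_eq] at *
  obtain ⟨⟨ha1, ha2⟩, ha3⟩ := ha
  obtain ⟨⟨hb1, hb2⟩, hb3⟩ := hb
  obtain ⟨h1, h2⟩ := hρ
  have hρ0 : 0 < ρ := hr.trans_le h1
  refine ⟨⟨hstar.add_smul_sub_mem ha1 hρ0.le h2, fun hi => hb2 ?_⟩, ?_⟩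
  · have := ray_mem_interior hstar hi (k := r / ρ) (by positivity) ((div_le_one hρ0).2 h1)
    rwa [add_sub_cancel_left, smul_smul, div_mul_cancel₀ _ hρ0.ne'] at this
  · simp only [mem_setOf_eq, inner_ray] at *
    rcases le_total (inner ℝ v a - inner ℝ v c : ℝ) 0 with h | h <;> nlinarith

lemma radial_disjoint {M : Set E} (hMc : IsClosed M) {c : E} (hstar : StarConvex ℝ c M)
    {v : E} {t : ℝ} {A B : Set E} (hA : IsClosed A) (hB : IsClosed B)
    (hAB : Disjoint A B)
    (hU : A ∪ B = frontier M ∩ {x | (inner ℝ v x : ℝ) ≤ t})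
    {a b : E} (ha : a ∈ A) (hb : b ∈ B) {r : ℝ} (hr : 0 < r) (hr1 : r ≤ 1)
    (h : b = c + r • (a - c)) : False := by
  have hc : IsPreconnected ((fun ρ : ℝ => c + ρ • (a - c)) '' Icc r 1) :=
    isPreconnected_Icc.image _ (by fun_prop)
  have hsub : (fun ρ : ℝ => c + ρ • (a - c)) '' Icc r 1 ⊆ A ∪ B := by
    rintro _ ⟨ρ, hρ, rfl⟩
    rw [hU]
    exact seg_subset hMc hstar (hU ▸ Or.inl ha) hr (h ▸ hU ▸ Or.inr hb) hρ
  obtain ⟨z, -, hz1, hz2⟩ := (isPreconnected_closed_iff.1 hc) A B hA hB hsub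
    ⟨a, ⟨1, ⟨hr1, le_rfl⟩, by simp⟩, ha⟩ ⟨b, ⟨r, ⟨le_rfl, hr1⟩, h.symm⟩, hb⟩
  exact hAB.le_bot ⟨hz1, hz2⟩

lemma exists_outer {M : Set E} (hM : IsCompact M) {c : E} {x : E} (hx : x ∈ M) (hxc : x ≠ c) :
    ∃ k : ℝ, 1 ≤ k ∧ c + k • (x - c) ∈ frontier M := by
  set f : ℝ → E := fun k => c + k • (x - c) with hf
  have hfc : Continuous f := by fun_prop
  have hn : 0 < ‖x - c‖ := norm_pos_iff.2 (sub_ne_zero.2 hxc)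
  obtain ⟨R, hR⟩ := hM.isBounded.subset_closedBall c
  have hK : IsCompact (Ici (1:ℝ) ∩ f ⁻¹' M) := by
    refine (isCompact_Icc (a := (1:ℝ)) (b := R / ‖x - c‖)).of_isClosed_subset
      (isClosed_Ici.inter (hM.isClosed.preimage hfc)) ?_
    rintro k ⟨hk, hkM⟩
    refine ⟨hk, (le_div_iff₀ hn).2 ?_⟩
    have := hR hkM
    have hk0 : (0:ℝ) ≤ k := zero_le_one.trans hk
    simpa [hf, dist_eq_norm, norm_smul, abs_of_nonneg hk0] using this
  obtain ⟨k, ⟨hk1, hkM⟩, hmax⟩ := hK.exists_isGreatest ⟨1, mem_Ici.2 le_rfl, by simpa [hf] using hx⟩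
  refine ⟨k, hk1, ?_⟩
  rw [hM.isClosed.frontier_eq]
  refine ⟨hkM, fun hi => ?_⟩
  have hnh : f ⁻¹' interior M ∈ 𝓝 k := (isOpen_interior.preimage hfc).mem_nhds hi
  have hnh' : f ⁻¹' interior M ∈ 𝓝[>] k := nhdsWithin_le_nhds hnh
  have hself : Ioi k ∈ 𝓝[>] k := self_mem_nhdsWithin
  obtain ⟨l, hl, hlM⟩ := Filter.nonempty_of_mem (Filter.inter_mem hself hnh')
  have hkl : k < l := hl
  have hlM' : f l ∈ M := interior_subset (s := M) hlM
  exact absurd (hmax ⟨le_trans hk1 hkl.le, hlM'⟩) (not_le.2 hkl)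

lemma exists_separation {F : Set E} (hF : IsCompact F) {x y : E} (hx : x ∈ F) (hy : y ∈ F)
    (h : y ∉ connectedComponentIn F x) :
    ∃ A B : Set E, IsCompact A ∧ IsCompact B ∧ Disjoint A B ∧ A ∪ B = F ∧ x ∈ A ∧ y ∈ B := by
  haveI : CompactSpace F := isCompact_iff_compactSpace.1 hF
  rw [connectedComponentIn_eq_image hx, connectedComponent_eq_iInter_isClopen] at h
  have h' : (⟨y, hy⟩ : F) ∉ ⋂ s : { s : Set F // IsClopen s ∧ (⟨x, hx⟩ : F) ∈ s }, s.1 :=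
    fun hh => h ⟨_, hh, rfl⟩
  simp only [mem_iInter, not_forall] at h'
  obtain ⟨⟨s, hs, hxs⟩, hys⟩ := h'
  refine ⟨(↑) '' s, (↑) '' sᶜ, hs.isClosed.isCompact.image continuous_subtype_val,
    hs.compl.isClosed.isCompact.image continuous_subtype_val, ?_, ?_, ⟨_, hxs, rfl⟩,
    ⟨_, hys, rfl⟩⟩
  · exact (disjoint_image_iff Subtype.val_injective).2 disjoint_compl_right
  · rw [← image_union, union_compl_self, image_univ, Subtype.range_coe]

end Helpers


/-- Let `M ⊆ ℝ^d` be compact and star-shaped with center `c`, and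
`t < ⟪v,c⟫`. Then the inclusion `(∂M)_{v,t} ⊆ M_{v,t}` induces a bijection on
connected components: (i) every connected component of `M_{v,t}` meets
`(∂M)_{v,t}`, and (ii) two points of `(∂M)_{v,t}` are in the same component of
`(∂M)_{v,t}` iff they are in the same component of `M_{v,t}`. -/
theorem boundary_sublevel_component_bijection
    (d : ℕ) (hd : 1 ≤ d)
    (M : Set (EuclideanSpace ℝ (Fin d))) (hM : IsCompact M)
    (c : EuclideanSpace ℝ (Fin d)) (hcM : c ∈ M) (hstar : StarConvex ℝ c M)
    (v : EuclideanSpace ℝ (Fin d)) (t : ℝ)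
    (ht : t < (inner ℝ v c : ℝ))
    (S : Set (EuclideanSpace ℝ (Fin d)))
    (hS : S = {x ∈ M | (inner ℝ v x : ℝ) ≤ t})
    (F : Set (EuclideanSpace ℝ (Fin d)))
    (hF : F = frontier M ∩ {x | (inner ℝ v x : ℝ) ≤ t}) :
    (∀ x ∈ S, (connectedComponentIn S x ∩ F).Nonempty) ∧
    (∀ x ∈ F, ∀ y ∈ F,
      (y ∈ connectedComponentIn F x ↔ y ∈ connectedComponentIn S x)) := by
  have hMc := hM.isClosed
  have hFS : F ⊆ S := by
    rw [hF, hS]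
    exact fun z hz => ⟨hMc.frontier_subset hz.1, hz.2⟩
  have hne : ∀ z ∈ S, z ≠ c := by
    rintro z hz rfl
    rw [hS] at hz
    exact absurd hz.2 (not_le.2 ht)
  have hout : ∀ z ∈ S, ∃ k : ℝ, 1 ≤ k ∧ c + k • (z - c) ∈ F ∧
      ∀ l ∈ Icc (1:ℝ) k, c + l • (z - c) ∈ S := by
    intro z hz
    have hz' := hz
    rw [hS] at hz'
    obtain ⟨k, hk1, hk⟩ := exists_outer hM hz'.1 (hne z hz)
    have hlev : ∀ l : ℝ, 1 ≤ l → (inner ℝ v (c + l • (z - c)) : ℝ) ≤ t := by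
      intro l hl
      rw [inner_ray]
      have := hz'.2
      nlinarith
    refine ⟨k, hk1, ?_, fun l hl => ?_⟩
    · rw [hF]
      exact ⟨hk, hlev k hk1⟩
    · rw [hS]
      refine ⟨?_, hlev l hl.1⟩
      have hk0 : 0 < k := by linarith
      have := hstar.add_smul_sub_mem (hMc.frontier_subset hk) (t := l / k)
        (div_nonneg (by linarith [hl.1]) hk0.le) ((div_le_one hk0).2 hl.2)
      rwa [add_sub_cancel_left, smul_smul, div_mul_cancel₀ _ hk0.ne'] at this
  refine ⟨fun x hx => ?_, fun x hx y hy => ⟨fun h => connectedComponentIn_mono x hFS h, ?_⟩⟩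
  · obtain ⟨k, hk1, hkF, hseg⟩ := hout x hx
    refine ⟨_, ?_, hkF⟩
    have hc : IsPreconnected ((fun l : ℝ => c + l • (x - c)) '' Icc 1 k) :=
      isPreconnected_Icc.image _ (by fun_prop)
    refine hc.subset_connectedComponentIn ⟨1, ⟨le_rfl, hk1⟩, by simp⟩ ?_
      ⟨k, ⟨hk1, le_rfl⟩, rfl⟩
    rintro _ ⟨l, hl, rfl⟩
    exact hseg l hl
  · intro hyS
    by_contra hcon
    have hFc : IsCompact F := by
      rw [hF]
      refine (hM.of_isClosed_subset isClosed_frontier hMc.frontier_subset).inter_right ?_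
      exact isClosed_le (by fun_prop) continuous_const
    obtain ⟨A, B, hA, hB, hdis, hU, hxA, hyB⟩ := exists_separation hFc hx hy hcon
    let g : ℝ × EuclideanSpace ℝ (Fin d) → EuclideanSpace ℝ (Fin d) :=
      fun p => c + p.1 • (p.2 - c)
    have hg : Continuous g := by fun_prop
    have hA' : IsClosed (g '' (Icc 0 1 ×ˢ A)) := ((isCompact_Icc.prod hA).image hg).isClosed
    have hB' : IsClosed (g '' (Icc 0 1 ×ˢ B)) := ((isCompact_Icc.prod hB).image hg).isClosed
    have hcov : connectedComponentIn S x ⊆ g '' (Icc 0 1 ×ˢ A) ∪ g '' (Icc 0 1 ×ˢ B) := by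
      intro z hz
      obtain ⟨k, hk1, hkF, -⟩ := hout z (connectedComponentIn_subset _ _ hz)
      have hk0 : 0 < k := by linarith
      have hzz : g (k⁻¹, c + k • (z - c)) = z := by
        simp [g, smul_smul, inv_mul_cancel₀ hk0.ne']
      have hki : k⁻¹ ∈ Icc (0:ℝ) 1 := ⟨by positivity, inv_le_one_of_one_le₀ hk1⟩
      rw [← hU] at hkF
      rcases hkF with h | h
      · exact Or.inl ⟨_, ⟨hki, h⟩, hzz⟩
      · exact Or.inr ⟨_, ⟨hki, h⟩, hzz⟩
    obtain ⟨z, hzS, ⟨⟨p, a⟩, ⟨hp, ha⟩, hpa⟩, ⟨⟨q, b⟩, ⟨hq, hb⟩, hqb⟩⟩ :=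
      (isPreconnected_closed_iff.1 isPreconnected_connectedComponentIn) _ _ hA' hB' hcov
        ⟨x, mem_connectedComponentIn (hFS hx), (1, x), ⟨by simp, hxA⟩, by simp [g]⟩
        ⟨y, hyS, (1, y), ⟨by simp, hyB⟩, by simp [g]⟩
    have hzc := hne z (connectedComponentIn_subset _ _ hzS)
    simp only [g] at hpa hqb hp hq ha hb
    have hp0 : 0 < p := lt_of_le_of_ne hp.1 (by rintro rfl; exact hzc (by simpa using hpa.symm))
    have hq0 : 0 < q := lt_of_le_of_ne hq.1 (by rintro rfl; exact hzc (by simpa using hqb.symm))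
    have heq : p • (a - c) = q • (b - c) := add_left_cancel (hpa.trans hqb.symm)
    rw [hF] at hU
    rcases le_total p q with h | h
    · refine radial_disjoint hMc hstar hA.isClosed hB.isClosed hdis hU ha hb
        (r := p / q) (by positivity) ((div_le_one hq0).2 h) ?_
      rw [div_eq_inv_mul, mul_smul, heq, smul_smul, inv_mul_cancel₀ hq0.ne']
      simp
    · refine radial_disjoint hMc hstar hB.isClosed hA.isClosed hdis.symm
        ((union_comm _ _).trans hU) hb ha
        (r := q / p) (by positivity) ((div_le_one hp0).2 h) ?_
      rw [div_eq_inv_mul, mul_smul, ← heq, smul_smul, inv_mul_cancel₀ hp0.ne']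
      simp
end

section
/- Let n ≥ 3, let w : Fin n → ℝ² be points (indices mod n) and let B = ⋃_j segment ℝ (w j) (w (j+1)) be the associated polygon boundary. Then for every v ∈ ℝ², t ∈ ℝ, and x ∈ B_{v,t} = {y ∈ B | ⟪v,y⟫ ≤ t}, there exists an index j such that w j ∈ connectedComponentIn B_{v,t} x (in particular ⟪v, w j⟫ ≤ t): every connected component of the sublevel set of the polygon boundary contains a vertex. -/
/-- Let `n ≥ 3` (written `n + 3`) and `w : Fin (n+3) → ℝ²` be points
(indices mod `n+3`), with polygon boundary `B = ⋃ j, segment ℝ (w j) (w (j+1))`.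
Then every connected component of the sublevel set `B_{v,t}` contains a vertex:
for every `x ∈ B_{v,t}` there is an index `j` with
`w j ∈ connectedComponentIn B_{v,t} x` (in particular `⟪v, w j⟫ ≤ t`). -/
theorem polygon_boundary_sublevel_component_contains_vertex
    (n : ℕ) (w : Fin (n + 3) → EuclideanSpace ℝ (Fin 2))
    (B : Set (EuclideanSpace ℝ (Fin 2)))
    (hB : B = ⋃ j : Fin (n + 3), segment ℝ (w j) (w (j + 1)))
    (v : EuclideanSpace ℝ (Fin 2)) (t : ℝ)
    (x : EuclideanSpace ℝ (Fin 2))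
    (hx : x ∈ {y ∈ B | (inner ℝ v y : ℝ) ≤ t}) :
    ∃ j : Fin (n + 3),
      w j ∈ connectedComponentIn {y ∈ B | (inner ℝ v y : ℝ) ≤ t} x ∧
      (inner ℝ v (w j) : ℝ) ≤ t := by
  obtain ⟨hxB, hxt⟩ := hx
  have hxB' := hxB
  rw [hB, Set.mem_iUnion] at hxB'
  obtain ⟨j, hj⟩ := hxB'
  have hlin : IsLinearMap ℝ (fun y : EuclideanSpace ℝ (Fin 2) => (inner ℝ v y : ℝ)) :=
    (innerₛₗ ℝ v).isLinear
  have hconv : Convex ℝ (segment ℝ (w j) (w (j + 1)) ∩ {y | (inner ℝ v y : ℝ) ≤ t}) :=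
    (convex_segment _ _).inter (convex_halfSpace_le hlin t)
  have hsub : segment ℝ (w j) (w (j + 1)) ∩ {y | (inner ℝ v y : ℝ) ≤ t} ⊆
      connectedComponentIn {y ∈ B | (inner ℝ v y : ℝ) ≤ t} x := by
    refine hconv.isPreconnected.subset_connectedComponentIn ⟨hj, hxt⟩ ?_
    rintro y ⟨hy, hyt⟩
    refine ⟨?_, hyt⟩
    rw [hB]
    exact Set.mem_iUnion.2 ⟨j, hy⟩
  by_cases h1 : (inner ℝ v (w j) : ℝ) ≤ t
  · exact ⟨j, hsub ⟨left_mem_segment ℝ _ _, h1⟩, h1⟩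
  by_cases h2 : (inner ℝ v (w (j + 1)) : ℝ) ≤ t
  · exact ⟨j + 1, hsub ⟨right_mem_segment ℝ _ _, h2⟩, h2⟩
  have h3 := (convex_halfSpace_gt hlin t).segment_subset (not_le.1 h1) (not_le.1 h2) hj
  exact absurd hxt (not_le.2 h3)
end

section
/- Let n ≥ 3 and let w : Fin n → ℝ² define a simple polygon with boundary B = ⋃_j segment ℝ (w j) (w (j+1)). Let v ∈ ℝ² and s ≤ t be real numbers such that ⟪v, w j⟫ ∉ [s,t] for every index j. Then the inclusion B_{v,s} ⊆ B_{v,t} induces a bijection on connected components; explicitly: (i) for every x ∈ B_{v,t}, the set connectedComponentIn B_{v,t} x ∩ B_{v,s} is nonempty; and (ii) for all x, y ∈ B_{v,s}, y ∈ connectedComponentIn B_{v,s} x if and only if y ∈ connectedComponentIn B_{v,t} x. -/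
/-- A list of `n + 3` points in `ℝ²` (indices mod `n + 3`) forms a simple polygon if
the points are pairwise distinct, consecutive edges meet exactly in their common
vertex, and non-consecutive edges are disjoint. -/
def IsSimplePolygon {n : ℕ} (w : Fin (n + 3) → EuclideanSpace ℝ (Fin 2)) : Prop :=
  Function.Injective w ∧
  (∀ j : Fin (n + 3),
    segment ℝ (w j) (w (j + 1)) ∩ segment ℝ (w (j + 1)) (w (j + 2)) = {w (j + 1)}) ∧
  (∀ j k : Fin (n + 3), k ≠ j → k ≠ j + 1 → j ≠ k + 1 →
    segment ℝ (w j) (w (j + 1)) ∩ segment ℝ (w k) (w (k + 1)) = ∅)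

lemma seg_unique {a b x y v : EuclideanSpace ℝ (Fin 2)} {s : ℝ}
    (ha : (inner ℝ v a : ℝ) ≠ s) (hx : x ∈ segment ℝ a b) (hy : y ∈ segment ℝ a b)
    (hxs : (inner ℝ v x : ℝ) = s) (hys : (inner ℝ v y : ℝ) = s) : x = y := by
  rw [segment_eq_image'] at hx hy
  obtain ⟨p, -, rfl⟩ := hx
  obtain ⟨q, -, rfl⟩ := hy
  simp only [inner_add_right, inner_smul_right] at hxs hys
  have h1 : (p - q) * (inner ℝ v (b - a) : ℝ) = 0 := by linarith
  rcases mul_eq_zero.mp h1 with h | h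
  · rw [sub_eq_zero.mp h]
  · rw [h] at hxs
    exact absurd (by linarith) ha

lemma seg_le {a b x v : EuclideanSpace ℝ (Fin 2)} {t : ℝ}
    (ha : (inner ℝ v a : ℝ) ≤ t) (hb : (inner ℝ v b : ℝ) ≤ t) (hx : x ∈ segment ℝ a b) :
    (inner ℝ v x : ℝ) ≤ t := by
  obtain ⟨p, q, hp, hq, hpq, rfl⟩ := hx
  simp only [inner_add_right, inner_smul_right]
  have : t = p * t + q * t := by rw [← add_mul, hpq, one_mul]
  nlinarith [mul_le_mul_of_nonneg_left ha hp, mul_le_mul_of_nonneg_left hb hq]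

lemma seg_gt {a b x v : EuclideanSpace ℝ (Fin 2)} {t : ℝ}
    (ha : t < (inner ℝ v a : ℝ)) (hb : t < (inner ℝ v b : ℝ)) (hx : x ∈ segment ℝ a b) :
    t < (inner ℝ v x : ℝ) := by
  obtain ⟨p, q, hp, hq, hpq, rfl⟩ := hx
  simp only [inner_add_right, inner_smul_right]
  have e : t = p * t + q * t := by rw [← add_mul, hpq, one_mul]
  rcases hp.eq_or_lt with h | h
  · subst h
    have : q = 1 := by linarith
    subst this
    linarith
  · nlinarith [mul_lt_mul_of_pos_left ha h, mul_le_mul_of_nonneg_left hb.le hq]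

/-- Let `w : Fin (n+3) → ℝ²` define a simple polygon with boundary
`B = ⋃ j, segment ℝ (w j) (w (j+1))`, and let `s ≤ t` with no vertex height
`⟪v, w j⟫` in `[s,t]`. Then the inclusion `B_{v,s} ⊆ B_{v,t}` induces a bijection
on connected components. -/
theorem polygon_boundary_components_iso_no_vertex
    (n : ℕ) (w : Fin (n + 3) → EuclideanSpace ℝ (Fin 2))
    (hsimple : IsSimplePolygon w)
    (B : Set (EuclideanSpace ℝ (Fin 2)))
    (hB : B = ⋃ j : Fin (n + 3), segment ℝ (w j) (w (j + 1)))
    (v : EuclideanSpace ℝ (Fin 2)) (s t : ℝ) (hst : s ≤ t)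
    (hvert : ∀ j : Fin (n + 3), (inner ℝ v (w j) : ℝ) ∉ Set.Icc s t)
    (Bs Bt : Set (EuclideanSpace ℝ (Fin 2)))
    (hBs : Bs = {y ∈ B | (inner ℝ v y : ℝ) ≤ s})
    (hBt : Bt = {y ∈ B | (inner ℝ v y : ℝ) ≤ t}) :
    (∀ x ∈ Bt, (connectedComponentIn Bt x ∩ Bs).Nonempty) ∧
    (∀ x ∈ Bs, ∀ y ∈ Bs,
      (y ∈ connectedComponentIn Bs x ↔ y ∈ connectedComponentIn Bt x)) := by
  classical
  obtain ⟨-, hcons, hdisj⟩ := hsimple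
  have hcont : Continuous fun x : EuclideanSpace ℝ (Fin 2) => (inner ℝ v x : ℝ) := by fun_prop
  have hEB : ∀ j, segment ℝ (w j) (w (j + 1)) ⊆ B := by
    intro j; rw [hB]; exact Set.subset_iUnion (fun j => segment ℝ (w j) (w (j + 1))) j
  have hsub : Bs ⊆ Bt := by
    rw [hBs, hBt]; exact fun x hx => ⟨hx.1, hx.2.trans hst⟩
  -- a low endpoint for each edge meeting `Bt`
  have hlow : ∀ j, ∀ x ∈ segment ℝ (w j) (w (j + 1)), (inner ℝ v x : ℝ) ≤ t →
      ∃ a ∈ Bs, segment ℝ a x ⊆ segment ℝ (w j) (w (j + 1)) := by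
    intro j x hx hxt
    have key : ∀ k, (inner ℝ v (w k) : ℝ) ≤ t → (inner ℝ v (w k) : ℝ) ≤ s := by
      intro k hk
      by_contra h
      exact hvert k ⟨(not_le.mp h).le, hk⟩
    have : ∃ k, w k ∈ segment ℝ (w j) (w (j + 1)) ∧ (inner ℝ v (w k) : ℝ) ≤ t := by
      by_contra! h
      have h1 := h j (left_mem_segment ℝ _ _)
      have h2 := h (j + 1) (right_mem_segment ℝ _ _)
      exact absurd (seg_gt h1 h2 hx) (not_lt.mpr hxt)
    obtain ⟨k, hk, hkt⟩ := this
    refine ⟨w k, ?_, (convex_segment _ _).segment_subset hk hx⟩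
    rw [hBs]
    exact ⟨hEB j hk, key k hkt⟩
  have huniq : ∀ j k, ∀ x ∈ segment ℝ (w j) (w (j + 1)), x ∈ segment ℝ (w k) (w (k + 1)) →
      (inner ℝ v x : ℝ) ∈ Set.Icc s t → j = k := by
    have aux : ∀ j, ∀ x ∈ segment ℝ (w j) (w (j + 1)),
        x ∈ segment ℝ (w (j + 1)) (w (j + 1 + 1)) → (inner ℝ v x : ℝ) ∉ Set.Icc s t := by
      intro j x hx hx'
      have e : j + 1 + 1 = j + 2 := by rw [add_assoc]; congr 1
      rw [e] at hx'
      have h : x ∈ segment ℝ (w j) (w (j + 1)) ∩ segment ℝ (w (j + 1)) (w (j + 2)) := ⟨hx, hx'⟩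
      rw [hcons j] at h
      rw [Set.mem_singleton_iff.mp h]
      exact hvert _
    intro j k x hj hk hx
    by_contra hne
    by_cases h1 : k = j + 1
    · subst h1; exact aux j x hj hk hx
    by_cases h2 : j = k + 1
    · subst h2; exact aux k x hk hj hx
    have := hdisj j k (Ne.symm hne) h1 h2
    exact (Set.ext_iff.mp this x).mp ⟨hj, hk⟩
  refine ⟨?_, ?_⟩
  · intro x hx
    have hx0 := hx
    rw [hBt, hB] at hx
    obtain ⟨hxB, hxt⟩ := hx
    obtain ⟨j, hj⟩ := Set.mem_iUnion.mp hxB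
    obtain ⟨a, ha, hseg⟩ := hlow j x hj hxt
    refine ⟨a, ?_, ha⟩
    have hat := hsub ha
    refine (convex_segment a x).isPreconnected.subset_connectedComponentIn
      (right_mem_segment ℝ a x) ?_ (left_mem_segment ℝ a x)
    intro y hy
    rw [hBt] at hat ⊢
    exact ⟨hEB j (hseg hy), seg_le hat.2 hxt hy⟩
  · intro x hx y hy
    refine ⟨fun h => connectedComponentIn_mono x hsub h, fun h => ?_⟩
    -- crossing points
    let P : Fin (n + 3) → EuclideanSpace ℝ (Fin 2) := fun j =>
      Classical.epsilon fun z => z ∈ segment ℝ (w j) (w (j + 1)) ∧ (inner ℝ v z : ℝ) = s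
    have hP : ∀ j, ∀ z ∈ segment ℝ (w j) (w (j + 1)), (inner ℝ v z : ℝ) ∈ Set.Icc s t →
        P j ∈ segment ℝ (w j) (w (j + 1)) ∧ (inner ℝ v (P j) : ℝ) = s := by
      intro j z hz hzs
      apply Classical.epsilon_spec
        (p := fun z => z ∈ segment ℝ (w j) (w (j + 1)) ∧ (inner ℝ v z : ℝ) = s)
      obtain ⟨a, ha, hseg⟩ := hlow j z hz hzs.2
      rw [hBs] at ha
      obtain ⟨c, hc, hcs⟩ := (convex_segment a z).isPreconnected.intermediate_value
        (left_mem_segment ℝ a z) (right_mem_segment ℝ a z) hcont.continuousOn ⟨ha.2, hzs.1⟩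
      exact ⟨c, hseg hc, hcs⟩
    let J : EuclideanSpace ℝ (Fin 2) → Fin (n + 3) := fun z =>
      Classical.epsilon fun j => z ∈ segment ℝ (w j) (w (j + 1))
    have hJ : ∀ j, ∀ z ∈ segment ℝ (w j) (w (j + 1)),
        z ∈ segment ℝ (w (J z)) (w (J z + 1)) := fun j z hz =>
      Classical.epsilon_spec (p := fun j => z ∈ segment ℝ (w j) (w (j + 1))) ⟨j, hz⟩
    let r : EuclideanSpace ℝ (Fin 2) → EuclideanSpace ℝ (Fin 2) := fun z =>
      if (inner ℝ v z : ℝ) ≤ s then z else P (J z)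
    have hr1 : ∀ z ∈ Bs, r z = z := by
      intro z hz
      rw [hBs] at hz
      exact if_pos hz.2
    let S : Fin (n + 3) → Set (EuclideanSpace ℝ (Fin 2)) := fun j =>
      segment ℝ (w j) (w (j + 1)) ∩ {z | (inner ℝ v z : ℝ) ∈ Set.Icc s t}
    have hr2 : ∀ j, ∀ z ∈ S j, r z = P j := by
      rintro j z ⟨hz, hzs⟩
      have hp := hP j z hz hzs
      by_cases hle : (inner ℝ v z : ℝ) ≤ s
      · have : r z = z := if_pos hle
        rw [this]
        refine seg_unique (s := s) ?_ hz hp.1 (le_antisymm hle hzs.1) hp.2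
        intro h
        exact hvert j ⟨h.ge, h.le.trans hst⟩
      · have : r z = P (J z) := if_neg hle
        rw [this, ← huniq j (J z) z hz (hJ j z hz) hzs]
    have hEc : ∀ j, IsClosed (segment ℝ (w j) (w (j + 1))) := fun j => by
      rw [← convexHull_pair]
      exact (Set.toFinite _).isClosed_convexHull ℝ
    have hSc : ∀ j, IsClosed (S j) := fun j => (hEc j).inter (isClosed_Icc.preimage hcont)
    have hBsc : IsClosed Bs := by
      rw [hBs, hB]
      exact (isClosed_iUnion_of_finite hEc).inter (isClosed_Iic.preimage hcont)
    have hc1 : ContinuousOn r Bs := continuousOn_id.congr hr1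
    have hc2 : ContinuousOn r (⋃ j, S j) :=
      (locallyFinite_of_finite S).continuousOn_iUnion hSc
        fun j => continuousOn_const.congr (hr2 j)
    have hc : ContinuousOn r (Bs ∪ ⋃ j, S j) :=
      hc1.union_of_isClosed hc2 hBsc (isClosed_iUnion_of_finite hSc)
    have hcov : Bt ⊆ Bs ∪ ⋃ j, S j := by
      intro z hz
      rw [hBt] at hz
      by_cases hle : (inner ℝ v z : ℝ) ≤ s
      · left; rw [hBs]; exact ⟨hz.1, hle⟩
      · right
        have hzB := hz.1
        rw [hB] at hzB
        obtain ⟨j, hj⟩ := Set.mem_iUnion.mp hzB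
        exact Set.mem_iUnion.mpr ⟨j, hj, (not_le.mp hle).le, hz.2⟩
    have hmap : ∀ z ∈ Bt, r z ∈ Bs := by
      intro z hz
      rcases hcov hz with h | h
      · rw [hr1 z h]; exact h
      · obtain ⟨j, hj⟩ := Set.mem_iUnion.mp h
        rw [hr2 j z hj, hBs]
        have hp := hP j z hj.1 hj.2
        exact ⟨hEB j hp.1, hp.2.le⟩
    have hCsub := connectedComponentIn_subset Bt x
    have hpre : IsPreconnected (r '' connectedComponentIn Bt x) :=
      isPreconnected_connectedComponentIn.image r (hc.mono (hCsub.trans hcov))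
    have hxm : x ∈ r '' connectedComponentIn Bt x :=
      ⟨x, mem_connectedComponentIn (hsub hx), hr1 x hx⟩
    refine hpre.subset_connectedComponentIn hxm ?_ ⟨y, h, hr1 y hy⟩
    rintro _ ⟨z, hz, rfl⟩
    exact hmap z (hCsub hz)
end

section
/- Let M ⊆ ℝ² be compact and star-shaped with center c, and suppose frontier M = B, where B is the boundary of a simple polygon with vertices w : Fin n → ℝ² (n ≥ 3). Let v ∈ ℝ² and s ≤ t < ⟪v,c⟫ be such that ⟪v, w j⟫ ∉ [s,t] for every index j. Then the inclusion M_{v,s} ⊆ M_{v,t} induces a bijection on connected components; explicitly: (i) for every x ∈ M_{v,t}, the set connectedComponentIn M_{v,t} x ∩ M_{v,s} is nonempty; and (ii) for all x, y ∈ M_{v,s}, y ∈ connectedComponentIn M_{v,s} x if and only if y ∈ connectedComponentIn M_{v,t} x. -/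
open Set Filter Topology

section Aux

variable {E : Type*} [NormedAddCommGroup E] [InnerProductSpace ℝ E]

lemma aux_seg_le {v a b z : E} {r : ℝ} (hz : z ∈ segment ℝ a b)
    (ha : (inner ℝ v a : ℝ) ≤ r) (hb : (inner ℝ v b : ℝ) ≤ r) : (inner ℝ v z : ℝ) ≤ r := by
  obtain ⟨p, q, hp, hq, hpq, rfl⟩ := hz
  rw [inner_add_right, inner_smul_right, inner_smul_right]
  have : r = p * r + q * r := by rw [← add_mul, hpq, one_mul]
  nlinarith [mul_le_mul_of_nonneg_left ha hp, mul_le_mul_of_nonneg_left hb hq]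

lemma aux_le_seg {v a b z : E} {r : ℝ} (hz : z ∈ segment ℝ a b)
    (ha : r ≤ (inner ℝ v a : ℝ)) (hb : r ≤ (inner ℝ v b : ℝ)) : r ≤ (inner ℝ v z : ℝ) := by
  obtain ⟨p, q, hp, hq, hpq, rfl⟩ := hz
  rw [inner_add_right, inner_smul_right, inner_smul_right]
  have : r = p * r + q * r := by rw [← add_mul, hpq, one_mul]
  nlinarith [mul_le_mul_of_nonneg_left ha hp, mul_le_mul_of_nonneg_left hb hq]

/-- every segment from a point of `M` to a point outside `M` hits the frontier -/
lemma aux_hit {M : Set E} {a b : E} (ha : a ∈ M) (hb : b ∉ M) :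
    ∃ p ∈ segment ℝ a b, p ∈ frontier M := by
  have h := (convex_segment (𝕜 := ℝ) a b).isPreconnected
  by_contra! hc
  have hpre := isPreconnected_iff_subset_of_disjoint.1 h (interior M) (closure M)ᶜ isOpen_interior
    isClosed_closure.isOpen_compl (by
      intro p hp
      have := hc p hp
      rw [frontier, mem_diff] at this
      by_cases hpi : p ∈ interior M
      · exact Or.inl hpi
      · refine Or.inr fun hcl => this ⟨hcl, hpi⟩) (by
      ext p
      simp only [mem_inter_iff, mem_compl_iff, mem_empty_iff_false, iff_false]
      rintro ⟨-, h1, h2⟩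
      exact h2 (subset_closure (interior_subset h1)))
  rcases hpre with hpre | hpre
  · exact hb (interior_subset (hpre (right_mem_segment ℝ a b)))
  · exact hpre (left_mem_segment ℝ a b) (subset_closure ha)

/-- close points of `M` in the strip are joined by a segment in `M` -/
lemma aux_close {ι : Type*} {A B : ι → E} {M : Set E} (hcl : IsClosed M)
    (hfront : frontier M = ⋃ j, segment ℝ (A j) (B j)) {v : E} {l u δ : ℝ}
    (hδ : ∀ i j, i ≠ j → ∀ p ∈ segment ℝ (A i) (B i), ∀ q ∈ segment ℝ (A j) (B j),
      (inner ℝ v p : ℝ) ∈ Icc l u → (inner ℝ v q : ℝ) ∈ Icc l u → δ ≤ dist p q)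
    {a b : E} (ha : a ∈ M) (hb : b ∈ M) (hal : (inner ℝ v a : ℝ) ∈ Icc l u)
    (hbl : (inner ℝ v b : ℝ) ∈ Icc l u) (hab : dist a b < δ) : segment ℝ a b ⊆ M := by
  intro z hz
  by_contra hzM
  obtain ⟨p, hp, hpf⟩ := aux_hit ha hzM
  obtain ⟨q, hq, hqf⟩ := aux_hit hb hzM
  rw [segment_symm] at hq
  have hzl : (inner ℝ v z : ℝ) ∈ Icc l u :=
    ⟨aux_le_seg hz hal.1 hbl.1, aux_seg_le hz hal.2 hbl.2⟩
  have hpl : (inner ℝ v p : ℝ) ∈ Icc l u :=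
    ⟨aux_le_seg hp hal.1 hzl.1, aux_seg_le hp hal.2 hzl.2⟩
  have hql : (inner ℝ v q : ℝ) ∈ Icc l u :=
    ⟨aux_le_seg hq hzl.1 hbl.1, aux_seg_le hq hzl.2 hbl.2⟩
  have hsub := hcl.frontier_subset
  have hpf' := hpf
  have hqf' := hqf
  rw [hfront, mem_iUnion] at hpf' hqf'
  obtain ⟨i, hi⟩ := hpf'
  obtain ⟨j, hj⟩ := hqf'
  have d1 := dist_add_dist_of_mem_segment hz
  have d2 := dist_add_dist_of_mem_segment hp
  have d3 := dist_add_dist_of_mem_segment hq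
  have d4 := dist_triangle p z q
  have n1 : 0 ≤ dist a p := dist_nonneg
  have n2 : 0 ≤ dist q b := dist_nonneg
  have hij : i = j := by
    by_contra hne
    have := hδ i j hne p hi q hj hpl hql
    linarith
  subst hij
  have hzpq : z ∈ segment ℝ p q := by
    rw [mem_segment_iff_wbtw] at hz hp hq ⊢
    exact (hz.trans_left_right hp).trans_right_left hq
  have : z ∈ frontier M := by
    rw [hfront]
    exact mem_iUnion.2 ⟨i, (convex_segment _ _).segment_subset hi hj hzpq⟩
  exact hzM (hsub this)

/-- moving from `z` along the direction `d` of positive drop to height `τ`. -/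
lemma aux_move {v z d : E} {τ ε η D : ℝ} (hη : 0 < η) (hd : η ≤ -(inner ℝ v d : ℝ))
    (hD : ‖d‖ ≤ D) (hz : τ ≤ (inner ℝ v z : ℝ)) (hz' : (inner ℝ v z : ℝ) ≤ τ + ε) :
    ∃ r : ℝ, 0 ≤ r ∧ r * (-(inner ℝ v d : ℝ)) = inner ℝ v z - τ ∧
      (inner ℝ v (z + r • d) : ℝ) = τ ∧
      dist z (z + r • d) ≤ ε / η * D := by
  have hpos : 0 < -(inner ℝ v d : ℝ) := hη.trans_le hd
  have hr : 0 ≤ (inner ℝ v z - τ) / (-(inner ℝ v d : ℝ)) :=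
    div_nonneg (by linarith) hpos.le
  have hmul : (inner ℝ v z - τ) / (-(inner ℝ v d : ℝ)) * (-(inner ℝ v d : ℝ)) = inner ℝ v z - τ :=
    div_mul_cancel₀ _ hpos.ne'
  refine ⟨(inner ℝ v z - τ) / (-(inner ℝ v d : ℝ)), hr, hmul, ?_, ?_⟩
  · rw [inner_add_right, inner_smul_right]
    linarith
  · rw [dist_self_add_right, norm_smul, Real.norm_of_nonneg hr]
    refine mul_le_mul ?_ hD (norm_nonneg _) (div_nonneg (by linarith) hη.le)
    exact div_le_div₀ (by linarith) (by linarith) hη hd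

/-- the lower end of an edge -/
lemma aux_lower {A B q v : E} {s t η : ℝ} (hη : 0 < η)
    (hA : (inner ℝ v A : ℝ) ≤ s - η ∨ t < (inner ℝ v A : ℝ))
    (hB : (inner ℝ v B : ℝ) ≤ s - η ∨ t < (inner ℝ v B : ℝ))
    (hq : q ∈ segment ℝ A B) (hqt : (inner ℝ v q : ℝ) ≤ t) :
    ∃ w ∈ segment ℝ A B, (inner ℝ v w : ℝ) ≤ s - η := by
  rcases hA with hA | hA
  · exact ⟨A, left_mem_segment ℝ A B, hA⟩
  rcases hB with hB | hB
  · exact ⟨B, right_mem_segment ℝ A B, hB⟩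
  have := aux_le_seg hq (le_min hA.le hB.le |>.trans (min_le_left _ _) |> fun _ => min_le_left _ _)
    (min_le_right (inner ℝ v A : ℝ) (inner ℝ v B : ℝ))
  have h2 := lt_min hA hB
  linarith

/-- points of `M` slightly above height `τ` are close to points of `M` of height at most `τ` -/
lemma aux_near {ι : Type*} {A B : ι → E} {M : Set E} (hcl : IsClosed M)
    (hfront : frontier M = ⋃ j, segment ℝ (A j) (B j)) {v c : E} {s t η D ε τ τ' : ℝ}
    (hη : 0 < η) (hc : c ∈ M) (hct : η ≤ (inner ℝ v c : ℝ) - t)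
    (hA : ∀ j, (inner ℝ v (A j) : ℝ) ≤ s - η ∨ t < (inner ℝ v (A j) : ℝ))
    (hB : ∀ j, (inner ℝ v (B j) : ℝ) ≤ s - η ∨ t < (inner ℝ v (B j) : ℝ))
    (hD : ∀ x ∈ M, ∀ y ∈ M, ‖x - y‖ ≤ D)
    (hε : 0 ≤ ε) (hs : s ≤ τ) (hτ : τ' ≤ τ + ε) (ht : τ' ≤ t)
    {z : E} (hz : z ∈ M) (hzt : (inner ℝ v z : ℝ) ≤ τ') :
    ∃ p ∈ M, (inner ℝ v p : ℝ) ≤ τ ∧ dist z p ≤ 2 * (ε / η * D) := by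
  have hD0 : 0 ≤ D := (norm_nonneg _).trans (hD c hc c hc)
  have hK : 0 ≤ ε / η * D := by positivity
  rcases le_total (inner ℝ v z : ℝ) τ with h | h
  · exact ⟨z, hz, h, by rw [dist_self]; positivity⟩
  obtain ⟨r, hr, -, hrh, hrd⟩ := aux_move (v := v) (z := z) (d := z - c) (τ := τ) (ε := ε) (D := D)
    hη (by rw [inner_sub_right]; linarith) (hD z hz c hc) h (by linarith)
  by_cases hp : z + r • (z - c) ∈ M
  · exact ⟨_, hp, hrh.le, by linarith⟩
  obtain ⟨q, hq, hqf⟩ := aux_hit hz hp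
  have hqM := hcl.frontier_subset hqf
  have hqτ : τ ≤ (inner ℝ v q : ℝ) := aux_le_seg hq h hrh.ge
  have hqz : (inner ℝ v q : ℝ) ≤ τ' := aux_seg_le hq hzt (by linarith)
  have hdq := dist_add_dist_of_mem_segment hq
  have hdq' : 0 ≤ dist q (z + r • (z - c)) := dist_nonneg
  have hqf' := hqf
  rw [hfront, mem_iUnion] at hqf'
  obtain ⟨j, hj⟩ := hqf'
  obtain ⟨w, hw, hws⟩ := aux_lower hη (hA j) (hB j) hj (by linarith)
  have hwq : segment ℝ q w ⊆ M := fun x hx => hcl.frontier_subset (by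
    rw [hfront]; exact mem_iUnion.2 ⟨j, (convex_segment _ _).segment_subset hj hw hx⟩)
  obtain ⟨r', hr', hr1, hrh', hrd'⟩ := aux_move (v := v) (z := q) (d := w - q) (τ := τ) (ε := ε)
    (D := D) hη (by rw [inner_sub_right]; linarith) (hD w (hwq (right_mem_segment ℝ q w)) q hqM)
    hqτ (by linarith)
  refine ⟨q + r' • (w - q), hwq ?_, hrh'.le, ?_⟩
  · rw [segment_eq_image']
    refine ⟨r', ⟨hr', ?_⟩, rfl⟩
    rw [inner_sub_right] at hr1
    by_contra! hlt
    nlinarith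
  · have := dist_triangle z q (q + r' • (w - q))
    linarith

/-- separation of points in different components of a compact set -/
lemma aux_sep {S : Set E} (hS : IsCompact S) {x y : E} (hx : x ∈ S) (hy : y ∈ S)
    (hxy : y ∉ connectedComponentIn S x) :
    ∃ A B : Set E, IsCompact A ∧ IsCompact B ∧ Disjoint A B ∧ A ∪ B = S ∧ x ∈ A ∧ y ∈ B := by
  haveI : CompactSpace S := isCompact_iff_compactSpace.1 hS
  rw [connectedComponentIn_eq_image hx] at hxy
  have h1 : (⟨y, hy⟩ : S) ∉ connectedComponent (⟨x, hx⟩ : S) := fun h => hxy ⟨_, h, rfl⟩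
  rw [connectedComponent_eq_iInter_isClopen, mem_iInter] at h1
  push Not at h1
  obtain ⟨⟨Z, hZ, hxZ⟩, hyZ⟩ := h1
  refine ⟨(↑) '' Z, (↑) '' Zᶜ, hZ.isClosed.isCompact.image continuous_subtype_val,
    hZ.compl.isClosed.isCompact.image continuous_subtype_val, ?_, ?_, ⟨_, hxZ, rfl⟩, ⟨_, hyZ, rfl⟩⟩
  · exact (disjoint_image_iff Subtype.val_injective).2 disjoint_compl_right
  · rw [← image_union, union_compl_self, image_univ, Subtype.range_coe]

lemma aux_not_sep {S A B : Set E} (hA : IsClosed A) (hB : IsClosed B) (hd : Disjoint A B)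
    (hAB : S ⊆ A ∪ B) (hS : IsPreconnected S) {x y : E} (hx : x ∈ A) (hy : y ∈ B)
    (hxS : x ∈ S) (hyS : y ∈ S) : False := by
  obtain ⟨z, -, hz1, hz2⟩ := isPreconnected_closed_iff.1 hS A B hA hB hAB ⟨x, hxS, hx⟩ ⟨y, hyS, hy⟩
  exact disjoint_left.1 hd hz1 hz2

lemma aux_compl_nonempty {ι : Type*} {A B : ι → E} {M : Set E} (hM : IsCompact M)
    (hfront : frontier M = ⋃ j, segment ℝ (A j) (B j)) {v c : E} {s t η : ℝ}
    (hη : 0 < η) (hct : η ≤ (inner ℝ v c : ℝ) - t)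
    (hA : ∀ j, (inner ℝ v (A j) : ℝ) ≤ s - η ∨ t < (inner ℝ v (A j) : ℝ))
    (hB : ∀ j, (inner ℝ v (B j) : ℝ) ≤ s - η ∨ t < (inner ℝ v (B j) : ℝ))
    {x : E} (hx : x ∈ {y ∈ M | (inner ℝ v y : ℝ) ≤ t}) :
    (connectedComponentIn {y ∈ M | (inner ℝ v y : ℝ) ≤ t} x ∩
      {y ∈ M | (inner ℝ v y : ℝ) ≤ s}).Nonempty := by
  set S := {y ∈ M | (inner ℝ v y : ℝ) ≤ t} with hSdef
  have hcont : Continuous fun y : E => (inner ℝ v y : ℝ) := by fun_prop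
  have hS : IsCompact S := hM.inter_right (isClosed_le hcont continuous_const)
  have hK : IsCompact (connectedComponentIn S x) := by
    haveI : CompactSpace S := isCompact_iff_compactSpace.1 hS
    rw [connectedComponentIn_eq_image hx]
    exact isClosed_connectedComponent.isCompact.image continuous_subtype_val
  obtain ⟨q, hqK, hqmin⟩ := hK.exists_isMinOn ⟨x, mem_connectedComponentIn hx⟩ hcont.continuousOn
  have hqS := connectedComponentIn_subset S x hqK
  have key : ∀ p, segment ℝ q p ⊆ M → (inner ℝ v p : ℝ) < inner ℝ v q → False := by
    intro p hp hlt
    have hsub : segment ℝ q p ⊆ S := fun z hz =>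
      ⟨hp hz, aux_seg_le hz hqS.2 (hlt.le.trans hqS.2)⟩
    have := (convex_segment (𝕜 := ℝ) q p).isPreconnected.subset_connectedComponentIn
      (left_mem_segment ℝ q p) hsub (right_mem_segment ℝ q p)
    rw [← connectedComponentIn_eq hqK] at this
    have h2 : (inner ℝ v q : ℝ) ≤ inner ℝ v p := hqmin this
    linarith
  by_cases hqs : (inner ℝ v q : ℝ) ≤ s
  · exact ⟨q, hqK, hqS.1, hqs⟩
  exfalso
  push Not at hqs
  by_cases hqf : q ∈ frontier M
  · have hqf' := hqf
    rw [hfront, mem_iUnion] at hqf'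
    obtain ⟨j, hj⟩ := hqf'
    obtain ⟨w, hw, hws⟩ := aux_lower hη (hA j) (hB j) hj hqS.2
    refine key w (fun x hx => hM.isClosed.frontier_subset (by
      rw [hfront]; exact mem_iUnion.2 ⟨j, (convex_segment _ _).segment_subset hj hw hx⟩)) ?_
    linarith
  · have hqi : q ∈ interior M := by
      by_contra hqi
      exact hqf ⟨subset_closure hqS.1, hqi⟩
    obtain ⟨ρ, hρ, hball⟩ := Metric.isOpen_iff.1 isOpen_interior q hqi
    have hcq : Continuous fun r : ℝ => q + r • (q - c) := by fun_prop
    have hev : ∀ᶠ r : ℝ in 𝓝[>] 0, q + r • (q - c) ∈ Metric.ball q ρ := by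
      refine (hcq.tendsto 0).mono_left nhdsWithin_le_nhds ?_
      simpa using Metric.ball_mem_nhds q hρ
    obtain ⟨r, hr, hr0⟩ := (hev.and self_mem_nhdsWithin).exists
    have hr0 : 0 < r := hr0
    refine key (q + r • (q - c)) (((convex_ball q ρ).segment_subset
      (Metric.mem_ball_self hρ) hr).trans (hball.trans interior_subset)) ?_
    rw [inner_add_right, inner_smul_right, inner_sub_right]
    have := hqS.2
    nlinarith

/-- the one-step extension of a separation -/
lemma aux_step {ι : Type*} {A B : ι → E} {M : Set E} (hM : IsCompact M)
    (hfront : frontier M = ⋃ j, segment ℝ (A j) (B j)) {v c : E} {s t η D ε δ : ℝ}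
    (hη : 0 < η) (hc : c ∈ M) (hct : η ≤ (inner ℝ v c : ℝ) - t)
    (hA : ∀ j, (inner ℝ v (A j) : ℝ) ≤ s - η ∨ t < (inner ℝ v (A j) : ℝ))
    (hB : ∀ j, (inner ℝ v (B j) : ℝ) ≤ s - η ∨ t < (inner ℝ v (B j) : ℝ))
    (hD : ∀ x ∈ M, ∀ y ∈ M, ‖x - y‖ ≤ D) (hε : 0 ≤ ε)
    (hδ0 : 0 < δ) (hδv : ‖v‖ * δ ≤ η) (hεδ : 2 * (ε / η * D) ≤ δ / 3)
    (hδ : ∀ i j, i ≠ j → ∀ p ∈ segment ℝ (A i) (B i), ∀ q ∈ segment ℝ (A j) (B j),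
      (inner ℝ v p : ℝ) ∈ Icc (s - η) t → (inner ℝ v q : ℝ) ∈ Icc (s - η) t → δ ≤ dist p q)
    {P₀ Q₀ : Set E} (h0 : P₀ ∪ Q₀ = {y ∈ M | (inner ℝ v y : ℝ) ≤ s})
    (hne : P₀.Nonempty) (hne' : Q₀.Nonempty)
    (hPQ0 : ∀ p ∈ P₀, ∀ q ∈ Q₀, δ ≤ dist p q)
    {τ τ' : ℝ} (hs : s ≤ τ) (hττ : τ ≤ τ') (hτ : τ' ≤ τ + ε) (ht : τ' ≤ t)
    (hyp : ∃ P Q : Set E, IsClosed P ∧ IsClosed Q ∧ Disjoint P Q ∧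
      P ∪ Q = {y ∈ M | (inner ℝ v y : ℝ) ≤ τ} ∧ P₀ ⊆ P ∧ Q₀ ⊆ Q) :
    ∃ P Q : Set E, IsClosed P ∧ IsClosed Q ∧ Disjoint P Q ∧
      P ∪ Q = {y ∈ M | (inner ℝ v y : ℝ) ≤ τ'} ∧ P₀ ⊆ P ∧ Q₀ ⊆ Q := by
  obtain ⟨P, Q, hP, hQ, hPQ, hU, hPP, hQQ⟩ := hyp
  have hPM : ∀ p ∈ P, p ∈ M ∧ (inner ℝ v p : ℝ) ≤ τ := fun p hp => by
    have : p ∈ P ∪ Q := Or.inl hp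
    rwa [hU] at this
  have hQM : ∀ p ∈ Q, p ∈ M ∧ (inner ℝ v p : ℝ) ≤ τ := fun p hp => by
    have : p ∈ P ∪ Q := Or.inr hp
    rwa [hU] at this
  -- the distance bound
  have hdist : ∀ p ∈ P, ∀ q ∈ Q, δ ≤ dist p q := by
    intro p hp q hq
    by_contra! hlt
    have hdiff : |(inner ℝ v p : ℝ) - inner ℝ v q| ≤ η := by
      rw [← inner_sub_right]
      refine (abs_real_inner_le_norm _ _).trans (le_trans ?_ hδv)
      rw [← dist_eq_norm]
      exact mul_le_mul_of_nonneg_left hlt.le (norm_nonneg _)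
    rw [abs_le] at hdiff
    by_cases hps : (inner ℝ v p : ℝ) ≤ s ∧ (inner ℝ v q : ℝ) ≤ s
    · have hp0 : p ∈ P₀ := by
        have : p ∈ P₀ ∪ Q₀ := by rw [h0]; exact ⟨(hPM p hp).1, hps.1⟩
        exact this.resolve_right fun h => disjoint_left.1 hPQ hp (hQQ h)
      have hq0 : q ∈ Q₀ := by
        have : q ∈ P₀ ∪ Q₀ := by rw [h0]; exact ⟨(hQM q hq).1, hps.2⟩
        exact this.resolve_left fun h => disjoint_left.1 hPQ (hPP h) hq
      exact absurd (hPQ0 p hp0 q hq0) (not_le.2 hlt)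
    · have hpτ := (hPM p hp).2
      have hqτ := (hQM q hq).2
      have hlow : s - η ≤ (inner ℝ v p : ℝ) ∧ s - η ≤ (inner ℝ v q : ℝ) := by
        rw [not_and_or] at hps
        rcases hps with h | h <;> push Not at h <;> constructor <;> linarith
      have hseg := aux_close hM.isClosed hfront hδ (hPM p hp).1 (hQM q hq).1
        ⟨hlow.1, by linarith⟩ ⟨hlow.2, by linarith⟩ hlt
      refine aux_not_sep (S := segment ℝ p q) hP hQ hPQ ?_ (convex_segment p q).isPreconnected hp hq
        (left_mem_segment ℝ p q) (right_mem_segment ℝ p q)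
      rw [hU]
      exact fun z hz => ⟨hseg hz, aux_seg_le hz hpτ hqτ⟩
  have hcont : Continuous fun y : E => (inner ℝ v y : ℝ) := by fun_prop
  have hMcl : IsClosed {y ∈ M | (inner ℝ v y : ℝ) ≤ τ'} :=
    hM.isClosed.inter (isClosed_le hcont continuous_const)
  refine ⟨{y ∈ M | (inner ℝ v y : ℝ) ≤ τ'} ∩ {y | Metric.infDist y P ≤ δ / 3},
    {y ∈ M | (inner ℝ v y : ℝ) ≤ τ'} ∩ {y | Metric.infDist y Q ≤ δ / 3},
    hMcl.inter (isClosed_le (Metric.continuous_infDist_pt P) continuous_const),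
    hMcl.inter (isClosed_le (Metric.continuous_infDist_pt Q) continuous_const), ?_, ?_, ?_, ?_⟩
  · rw [disjoint_left]
    rintro z ⟨-, h1⟩ ⟨-, h2⟩
    have h1 : Metric.infDist z P < δ / 2 := lt_of_le_of_lt h1 (by linarith)
    have h2 : Metric.infDist z Q < δ / 2 := lt_of_le_of_lt h2 (by linarith)
    rw [Metric.infDist_lt_iff (hne.mono hPP)] at h1
    rw [Metric.infDist_lt_iff (hne'.mono hQQ)] at h2
    obtain ⟨p, hp, hp'⟩ := h1
    obtain ⟨q, hq, hq'⟩ := h2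
    have := hdist p hp q hq
    have := dist_triangle_left p q z
    linarith
  · rw [← inter_union_distrib_left]
    refine inter_eq_left.2 fun z hz => ?_
    obtain ⟨p, hp, hpτ, hpd⟩ := aux_near hM.isClosed hfront hη hc hct hA hB hD hε hs hτ ht hz.1 hz.2
    have : p ∈ P ∪ Q := by rw [hU]; exact ⟨hp, hpτ⟩
    rcases this with h | h
    · exact Or.inl ((Metric.infDist_le_dist_of_mem h).trans (hpd.trans hεδ))
    · exact Or.inr ((Metric.infDist_le_dist_of_mem h).trans (hpd.trans hεδ))
  · intro z hz
    have := hPM z (hPP hz)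
    refine ⟨⟨this.1, this.2.trans hττ⟩, ?_⟩
    show Metric.infDist z P ≤ δ / 3
    rw [Metric.infDist_zero_of_mem (hPP hz)]; positivity
  · intro z hz
    have := hQM z (hQQ hz)
    refine ⟨⟨this.1, this.2.trans hττ⟩, ?_⟩
    show Metric.infDist z Q ≤ δ / 3
    rw [Metric.infDist_zero_of_mem (hQQ hz)]; positivity

lemma aux_dist {S T : Set E} (hS : IsCompact S) (hT : IsCompact T) (h : Disjoint S T) :
    ∀ᶠ δ : ℝ in 𝓝[>] 0, ∀ p ∈ S, ∀ q ∈ T, δ ≤ dist p q := by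
  obtain ⟨r, hr, hrd⟩ := Metric.exists_pos_forall_lt_edist hS hT.isClosed h
  have : Iio (r : ℝ) ∈ 𝓝[>] (0 : ℝ) := mem_nhdsWithin_of_mem_nhds (Iio_mem_nhds (by exact_mod_cast hr))
  filter_upwards [this] with δ hδ p hp q hq
  have h1 := hrd p hp q hq
  rw [edist_nndist] at h1
  have h2 : (r : ℝ) < dist p q := by
    rw [← coe_nndist]
    exact_mod_cast h1
  exact (lt_trans hδ h2).le

end Aux



/-- Let `M ⊆ ℝ²` be compact and star-shaped with center `c`, whose
frontier is the boundary of a simple polygon with vertices `w`. Let `s ≤ t < ⟪v,c⟫`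
with no vertex height `⟪v, w j⟫` in `[s,t]`. Then the inclusion `M_{v,s} ⊆ M_{v,t}`
induces a bijection on connected components. -/
theorem polygon_sublevel_components_iso_no_vertex
    (n : ℕ) (w : Fin (n + 3) → EuclideanSpace ℝ (Fin 2))
    (hsimple : IsSimplePolygon w)
    (M : Set (EuclideanSpace ℝ (Fin 2))) (hM : IsCompact M)
    (c : EuclideanSpace ℝ (Fin 2)) (hcM : c ∈ M) (hstar : StarConvex ℝ c M)
    (hfront : frontier M = ⋃ j : Fin (n + 3), segment ℝ (w j) (w (j + 1)))
    (v : EuclideanSpace ℝ (Fin 2)) (s t : ℝ) (hst : s ≤ t)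
    (htc : t < (inner ℝ v c : ℝ))
    (hvert : ∀ j : Fin (n + 3), (inner ℝ v (w j) : ℝ) ∉ Set.Icc s t)
    (Ms Mt : Set (EuclideanSpace ℝ (Fin 2)))
    (hMs : Ms = {y ∈ M | (inner ℝ v y : ℝ) ≤ s})
    (hMt : Mt = {y ∈ M | (inner ℝ v y : ℝ) ≤ t}) :
    (∀ x ∈ Mt, (connectedComponentIn Mt x ∩ Ms).Nonempty) ∧
    (∀ x ∈ Ms, ∀ y ∈ Ms,
      (y ∈ connectedComponentIn Ms x ↔ y ∈ connectedComponentIn Mt x)) := by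
  subst hMs hMt
  obtain ⟨-, hs1, hs2⟩ := hsimple
  have hev : ∀ᶠ η : ℝ in 𝓝[>] 0, (η ≤ (inner ℝ v c : ℝ) - t ∧
      ∀ j, (inner ℝ v (w j) : ℝ) ≤ s - η - η ∨ t < (inner ℝ v (w j) : ℝ)) := by
    refine Filter.Eventually.and ?_ (Filter.eventually_all.2 fun j => ?_)
    · exact mem_nhdsWithin_of_mem_nhds (Iic_mem_nhds (by linarith))
    · by_cases h : (inner ℝ v (w j) : ℝ) < s
      · have : Iio ((s - (inner ℝ v (w j) : ℝ)) / 2) ∈ 𝓝[>] (0 : ℝ) :=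
          mem_nhdsWithin_of_mem_nhds (Iio_mem_nhds (by linarith))
        filter_upwards [this] with η hη
        left
        have hη : η < (s - (inner ℝ v (w j) : ℝ)) / 2 := hη
        linarith
      · refine Filter.Eventually.of_forall fun η => Or.inr ?_
        by_contra h2
        exact hvert j ⟨not_lt.1 h, not_lt.1 h2⟩
  obtain ⟨η, ⟨hct, hw⟩, hη⟩ := (hev.and self_mem_nhdsWithin).exists
  have hη : 0 < η := hη
  have hA : ∀ j, (inner ℝ v (w j) : ℝ) ≤ s - η ∨ t < (inner ℝ v (w j) : ℝ) := fun j =>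
    (hw j).imp_left fun h => by linarith
  have hB : ∀ j : Fin (n + 3), (inner ℝ v (w (j + 1)) : ℝ) ≤ s - η ∨ t < (inner ℝ v (w (j + 1)) : ℝ) :=
    fun j => hA (j + 1)
  have hcont : Continuous fun y : EuclideanSpace ℝ (Fin 2) => (inner ℝ v y : ℝ) := by fun_prop
  have hsubst : {y ∈ M | (inner ℝ v y : ℝ) ≤ s} ⊆ {y ∈ M | (inner ℝ v y : ℝ) ≤ t} :=
    fun z hz => ⟨hz.1, hz.2.trans hst⟩
  refine ⟨fun x hx => aux_compl_nonempty hM hfront hη hct hA hB hx, fun x hx y hy => ⟨fun h =>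
    connectedComponentIn_mono x hsubst h, fun h => ?_⟩⟩
  by_contra hxy
  have hMs : IsCompact {y ∈ M | (inner ℝ v y : ℝ) ≤ s} :=
    hM.inter_right (isClosed_le hcont continuous_const)
  obtain ⟨P₀, Q₀, hP0, hQ0, hd0, hU0, hxP, hyQ⟩ := aux_sep hMs hx hy hxy
  obtain ⟨D, hD0, hD⟩ : ∃ D : ℝ, 0 < D ∧ ∀ x ∈ M, ∀ y ∈ M, ‖x - y‖ ≤ D := by
    obtain ⟨D, hD⟩ := Metric.isBounded_iff.1 hM.isBounded
    refine ⟨max D 1, by positivity, fun x hx y hy => ?_⟩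
    rw [← dist_eq_norm]
    exact (hD hx hy).trans (le_max_left _ _)
  have hevd : ∀ᶠ δ : ℝ in 𝓝[>] 0, ‖v‖ * δ ≤ η ∧ (∀ p ∈ P₀, ∀ q ∈ Q₀, δ ≤ dist p q) ∧
      ∀ i j : Fin (n + 3), i ≠ j → ∀ p ∈ segment ℝ (w i) (w (i + 1)),
        ∀ q ∈ segment ℝ (w j) (w (j + 1)),
      (inner ℝ v p : ℝ) ∈ Icc (s - η) t → (inner ℝ v q : ℝ) ∈ Icc (s - η) t → δ ≤ dist p q := by
    refine Filter.Eventually.and ?_ ((aux_dist hP0 hQ0 hd0).and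
      (Filter.eventually_all.2 fun i => Filter.eventually_all.2 fun j => ?_))
    · have hc : Continuous fun δ : ℝ => ‖v‖ * δ := by fun_prop
      have := (hc.tendsto 0).mono_left (nhdsWithin_le_nhds (s := Ioi 0))
      refine this (Iic_mem_nhds (by simpa using hη))
    · by_cases hij : i = j
      · exact Filter.Eventually.of_forall fun δ h => absurd hij h
      have hcs : IsClosed {y : EuclideanSpace ℝ (Fin 2) | (inner ℝ v y : ℝ) ∈ Icc (s - η) t} :=
        isClosed_Icc.preimage hcont
      have hseg : ∀ a b : EuclideanSpace ℝ (Fin 2), IsCompact (segment ℝ a b) := fun a b => by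
        rw [segment_eq_image_lineMap]
        exact isCompact_Icc.image AffineMap.lineMap_continuous
      have hno : ∀ k, (inner ℝ v (w k) : ℝ) ∉ Icc (s - η) t := fun k hk => by
        rcases hw k with h | h
        · linarith [hk.1]
        · linarith [hk.2]
      have e2 : ∀ k : Fin (n + 3), k + 1 + 1 = k + 2 := fun k => by
        rw [add_assoc]; congr 1
      have := aux_dist ((hseg (w i) (w (i + 1))).inter_right hcs)
        ((hseg (w j) (w (j + 1))).inter_right hcs) (by
          rw [disjoint_left]
          rintro z ⟨hz1, hz2⟩ ⟨hz3, -⟩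
          by_cases h1 : j = i + 1
          · subst h1
            rw [e2] at hz3
            have : z ∈ ({w (i + 1)} : Set _) := by rw [← hs1 i]; exact ⟨hz1, hz3⟩
            rw [mem_singleton_iff] at this
            subst this
            exact hno _ hz2
          by_cases h2 : i = j + 1
          · subst h2
            rw [e2] at hz1
            have : z ∈ ({w (j + 1)} : Set _) := by rw [← hs1 j]; exact ⟨hz3, hz1⟩
            rw [mem_singleton_iff] at this
            subst this
            exact hno _ hz2
          have : z ∈ (∅ : Set _) := by
            rw [← hs2 i j (Ne.symm hij) h1 h2]; exact ⟨hz1, hz3⟩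
          exact this)
      filter_upwards [this] with δ hδ _ p hp q hq hp' hq'
      exact hδ p ⟨hp, hp'⟩ q ⟨hq, hq'⟩
  obtain ⟨δ, ⟨hδv, hPQ0, hδ⟩, hδ0⟩ := (hevd.and self_mem_nhdsWithin).exists
  have hδ0 : 0 < δ := hδ0
  obtain ⟨ε, hε, hεδ⟩ : ∃ ε : ℝ, 0 < ε ∧ 2 * (ε / η * D) ≤ δ / 3 :=
    ⟨δ * η / (6 * D), by positivity, by field_simp; norm_num⟩
  have hind : ∀ k : ℕ, ∃ P Q : Set (EuclideanSpace ℝ (Fin 2)), IsClosed P ∧ IsClosed Q ∧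
      Disjoint P Q ∧ P ∪ Q = {y ∈ M | (inner ℝ v y : ℝ) ≤ min (s + k * ε) t} ∧
      P₀ ⊆ P ∧ Q₀ ⊆ Q := by
    intro k
    induction k with
    | zero =>
      refine ⟨P₀, Q₀, hP0.isClosed, hQ0.isClosed, hd0, ?_, Subset.rfl, Subset.rfl⟩
      rw [hU0]
      simp [min_eq_left hst]
    | succ k ih =>
      have hk : (0 : ℝ) ≤ k * ε := by positivity
      refine aux_step hM hfront hη hcM hct hA hB hD hε.le hδ0 hδv hεδ hδ hU0 ⟨x, hxP⟩ ⟨y, hyQ⟩ hPQ0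
        (le_min (by linarith) hst) ?_ ?_ (min_le_right _ _) ih
      · refine min_le_min_right _ ?_
        push_cast
        linarith
      · rw [← min_add_add_right]
        push_cast
        refine min_le_min ?_ ?_ <;> linarith
  obtain ⟨k, hk⟩ := exists_nat_ge ((t - s) / ε)
  rw [div_le_iff₀ hε] at hk
  obtain ⟨P, Q, hP, hQ, hPQ, hU, hPP, hQQ⟩ := hind k
  rw [min_eq_right (by linarith)] at hU
  exact aux_not_sep hP hQ hPQ (by rw [hU]; exact connectedComponentIn_subset _ x)
    isPreconnected_connectedComponentIn (hPP hxP) (hQQ hyQ)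
    (mem_connectedComponentIn (hsubst hx)) h
end

section
/- Let n ≥ 3 and let w : Fin n → ℝ² define a simple polygon with boundary B = ⋃_j segment ℝ (w j) (w (j+1)). Let v ∈ ℝ² and s ≤ t be real numbers, and suppose i is an index such that ⟪v, w i⟫ ∈ [s,t] and ⟪v, w j⟫ ∉ [s,t] for every j ≠ i. Then every connected component of B_{v,t} either meets B_{v,s} or contains w i: for every x ∈ B_{v,t}, either connectedComponentIn B_{v,t} x ∩ B_{v,s} ≠ ∅ or w i ∈ connectedComponentIn B_{v,t} x. In particular, at most one connected component of B_{v,t} is disjoint from B_{v,s}. -/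
/-- Let `w : Fin (n+3) → ℝ²` define a simple polygon with boundary `B`,
let `s ≤ t`, and suppose `i` is the unique index with vertex height `⟪v, w i⟫` in
`[s,t]`. Then every connected component of `B_{v,t}` either meets `B_{v,s}` or
contains `w i`; in particular at most one component of `B_{v,t}` is disjoint from
`B_{v,s}`. -/
theorem polygon_boundary_new_component_contains_new_vertex
    (n : ℕ) (w : Fin (n + 3) → EuclideanSpace ℝ (Fin 2))
    (hsimple : IsSimplePolygon w)
    (B : Set (EuclideanSpace ℝ (Fin 2)))
    (hB : B = ⋃ j : Fin (n + 3), segment ℝ (w j) (w (j + 1)))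
    (v : EuclideanSpace ℝ (Fin 2)) (s t : ℝ) (hst : s ≤ t)
    (i : Fin (n + 3)) (hi : (inner ℝ v (w i) : ℝ) ∈ Set.Icc s t)
    (hother : ∀ j : Fin (n + 3), j ≠ i → (inner ℝ v (w j) : ℝ) ∉ Set.Icc s t)
    (Bs Bt : Set (EuclideanSpace ℝ (Fin 2)))
    (hBs : Bs = {y ∈ B | (inner ℝ v y : ℝ) ≤ s})
    (hBt : Bt = {y ∈ B | (inner ℝ v y : ℝ) ≤ t}) :
    (∀ x ∈ Bt, (connectedComponentIn Bt x ∩ Bs).Nonempty ∨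
      w i ∈ connectedComponentIn Bt x) ∧
    (∀ x ∈ Bt, ∀ y ∈ Bt,
      connectedComponentIn Bt x ∩ Bs = ∅ → connectedComponentIn Bt y ∩ Bs = ∅ →
      connectedComponentIn Bt x = connectedComponentIn Bt y) := by
  have key : ∀ x ∈ Bt, (connectedComponentIn Bt x ∩ Bs).Nonempty ∨
      w i ∈ connectedComponentIn Bt x := by
    intro x hx
    have hx' := hx
    rw [hBt, hB] at hx'
    obtain ⟨hxB, hxt⟩ := hx'
    obtain ⟨j, hj⟩ := Set.mem_iUnion.1 hxB
    have hend : ∃ k : Fin (n + 3), w k ∈ segment ℝ (w j) (w (j + 1)) ∧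
        (inner ℝ v (w k) : ℝ) ≤ inner ℝ v x := by
      by_contra! hcon
      have h1 := hcon j (left_mem_segment ℝ _ _)
      have h2 := hcon (j + 1) (right_mem_segment ℝ _ _)
      obtain ⟨a, b, ha, hb, hab, rfl⟩ := hj
      rw [inner_add_right, inner_smul_right, inner_smul_right] at h1 h2
      have hb' : b = 1 - a := by linarith
      subst hb'
      rcases ha.eq_or_lt with h0 | h0
      · subst h0
        linarith
      · nlinarith
    obtain ⟨k, hk, hkx⟩ := hend
    have hsub : segment ℝ x (w k) ⊆ Bt := by
      intro y hy
      rw [hBt, hB]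
      refine ⟨Set.mem_iUnion.2 ⟨j, (convex_segment _ _).segment_subset hj hk hy⟩, ?_⟩
      obtain ⟨a, b, ha, hb, hab, rfl⟩ := hy
      rw [inner_add_right, inner_smul_right, inner_smul_right]
      have hb' : b = 1 - a := by linarith
      subst hb'
      nlinarith
    have hkC : w k ∈ connectedComponentIn Bt x :=
      (convex_segment x (w k)).isPreconnected.subset_connectedComponentIn
        (left_mem_segment ℝ _ _) hsub (right_mem_segment ℝ _ _)
    by_cases hki : k = i
    · right
      rw [← hki]
      exact hkC
    · left
      refine ⟨w k, hkC, ?_⟩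
      rw [hBs, hB]
      refine ⟨Set.mem_iUnion.2 ⟨j, hk⟩, ?_⟩
      by_contra! hlt
      exact hother k hki ⟨hlt.le, hkx.trans hxt⟩
  refine ⟨key, fun x hx y hy hxs hys => ?_⟩
  have h1 := (key x hx).resolve_left (by simp [hxs])
  have h2 := (key y hy).resolve_left (by simp [hys])
  exact (connectedComponentIn_eq h1).trans (connectedComponentIn_eq h2).symm
end

section
/- Let n ≥ 3 and let w : Fin n → ℝ² define a simple polygon with boundary B = ⋃_j segment ℝ (w j) (w (j+1)). Let v ∈ ℝ² and s ≤ t be real numbers, and suppose there is exactly one index i with ⟪v, w i⟫ ∈ [s,t]. For x, y ∈ B_{v,s} write x ~_s y when y ∈ connectedComponentIn B_{v,s} x and x ~_t y when y ∈ connectedComponentIn B_{v,t} x. Then at most one pair of connected components of B_{v,s} merges in B_{v,t}: if x, y ∈ B_{v,s} satisfy x ~_t y and ¬(x ~_s y), and x', y' ∈ B_{v,s} satisfy x' ~_t y' and ¬(x' ~_s y'), then (x ~_s x' and y ~_s y') or (x ~_s y' and y ~_s x'). -/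
theorem poly_inter_vertex {n : ℕ} {w : Fin (n + 3) → EuclideanSpace ℝ (Fin 2)}
    (hs : IsSimplePolygon w) {j k : Fin (n + 3)} (hjk : j ≠ k) {p : EuclideanSpace ℝ (Fin 2)}
    (hj : p ∈ segment ℝ (w j) (w (j + 1))) (hk : p ∈ segment ℝ (w k) (w (k + 1))) :
    ∃ m, p = w m ∧ ((j = m ∧ k + 1 = m) ∨ (k = m ∧ j + 1 = m)) := by
  obtain ⟨-, h1, h2⟩ := hs
  have h2' : ∀ j : Fin (n + 3), j + 1 + 1 = j + 2 := fun j => by rw [add_assoc]; rfl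
  by_cases a : k = j + 1
  · subst a
    have : p ∈ ({w (j + 1)} : Set _) := by
      rw [← h1 j]; exact ⟨hj, by rw [← h2']; exact hk⟩
    exact ⟨j + 1, this, Or.inr ⟨rfl, rfl⟩⟩
  by_cases b : j = k + 1
  · subst b
    have : p ∈ ({w (k + 1)} : Set _) := by
      rw [← h1 k]; exact ⟨hk, by rw [← h2']; exact hj⟩
    exact ⟨k + 1, this, Or.inl ⟨rfl, rfl⟩⟩
  have := h2 j k (Ne.symm hjk) a b
  exact absurd (Set.mem_inter hj hk) (by rw [this]; simp)

theorem seg_low {a b v p : EuclideanSpace ℝ (Fin 2)} {s : ℝ}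
    (hp : p ∈ segment ℝ a b) (h : (inner ℝ v p : ℝ) ≤ s) :
    (inner ℝ v a : ℝ) ≤ s ∨ (inner ℝ v b : ℝ) ≤ s := by
  obtain ⟨α, β, hα, hβ, hab, rfl⟩ := hp
  by_contra! hc
  rw [inner_add_right, inner_smul_right, inner_smul_right] at h
  have hb : β = 1 - α := by linarith
  subst hb
  rcases eq_or_lt_of_le hα with h0 | h0
  · subst h0; linarith
  · nlinarith [mul_lt_mul_of_pos_left hc.1 h0, mul_le_mul_of_nonneg_left hc.2.le hβ]

theorem half_convex (v : EuclideanSpace ℝ (Fin 2)) (t : ℝ) :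
    Convex ℝ {y : EuclideanSpace ℝ (Fin 2) | (inner ℝ v y : ℝ) ≤ t} :=
  convex_halfSpace_le (innerSL ℝ v).isBoundedLinearMap.toIsLinearMap t

theorem half_closed (v : EuclideanSpace ℝ (Fin 2)) (t : ℝ) :
    IsClosed {y : EuclideanSpace ℝ (Fin 2) | (inner ℝ v y : ℝ) ≤ t} :=
  isClosed_le (by fun_prop) continuous_const

theorem seg_closed (a b : EuclideanSpace ℝ (Fin 2)) : IsClosed (segment ℝ a b) := by
  rw [← convexHull_pair]
  exact ((Set.toFinite {a, b}).isCompact_convexHull ℝ).isClosed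

/-- A family of indices closed under intersections traps the connected component. -/
theorem comp_trap {N : ℕ} {K : Fin N → Set (EuclideanSpace ℝ (Fin 2))}
    (hK : ∀ j, IsClosed (K j)) (J : Set (Fin N))
    (hJ : ∀ j ∈ J, ∀ k, j ≠ k → (K j ∩ K k).Nonempty → k ∈ J)
    {S : Set (EuclideanSpace ℝ (Fin 2))} (hS : ∀ z ∈ S, ∃ j, z ∈ K j)
    {x y : EuclideanSpace ℝ (Fin 2)} (hxS : x ∈ S) {j₀ : Fin N} (hj₀ : j₀ ∈ J)
    (hx : x ∈ K j₀) (hy : y ∈ connectedComponentIn S x) : ∃ j ∈ J, y ∈ K j := by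
  by_contra! hc
  have hpre := isPreconnected_connectedComponentIn (F := S) (x := x)
  rw [isPreconnected_closed_iff] at hpre
  have hsub := connectedComponentIn_subset S x
  obtain ⟨z, hz, hz1, hz2⟩ := hpre (⋃ j ∈ J, K j) (⋃ j ∈ Jᶜ, K j)
    ((Set.toFinite J).isClosed_biUnion fun j _ => hK j)
    ((Set.toFinite Jᶜ).isClosed_biUnion fun j _ => hK j)
    (by
      intro z hz
      obtain ⟨j, hj⟩ := hS z (hsub hz)
      by_cases h : j ∈ J
      · exact Or.inl (Set.mem_biUnion h hj)
      · exact Or.inr (Set.mem_biUnion (show j ∈ Jᶜ from h) hj))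
    ⟨x, mem_connectedComponentIn hxS, Set.mem_biUnion hj₀ hx⟩
    (by
      obtain ⟨j, hj⟩ := hS y (hsub hy)
      exact ⟨y, hy, Set.mem_biUnion (show j ∈ Jᶜ from fun h => hc j h hj) hj⟩)
  simp only [Set.mem_iUnion] at hz1 hz2
  obtain ⟨j, hj, hzj⟩ := hz1
  obtain ⟨k, hk, hzk⟩ := hz2
  exact hk (hJ j hj k (fun h => hk (h ▸ hj)) ⟨z, hzj, hzk⟩)

/-- Let `w : Fin (n+3) → ℝ²` define a simple polygon with boundary `B`,
let `s ≤ t`, and suppose there is exactly one index `i` with `⟪v, w i⟫ ∈ [s,t]`.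
Then at most one pair of connected components of `B_{v,s}` merges in `B_{v,t}`:
if `x ~_t y` but not `x ~_s y`, and `x' ~_t y'` but not `x' ~_s y'`, then
(`x ~_s x'` and `y ~_s y'`) or (`x ~_s y'` and `y ~_s x'`). -/
theorem polygon_boundary_at_most_one_merge
    (n : ℕ) (w : Fin (n + 3) → EuclideanSpace ℝ (Fin 2))
    (hsimple : IsSimplePolygon w)
    (B : Set (EuclideanSpace ℝ (Fin 2)))
    (hB : B = ⋃ j : Fin (n + 3), segment ℝ (w j) (w (j + 1)))
    (v : EuclideanSpace ℝ (Fin 2)) (s t : ℝ) (hst : s ≤ t)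
    (i : Fin (n + 3)) (hi : (inner ℝ v (w i) : ℝ) ∈ Set.Icc s t)
    (hother : ∀ j : Fin (n + 3), (inner ℝ v (w j) : ℝ) ∈ Set.Icc s t → j = i)
    (Bs Bt : Set (EuclideanSpace ℝ (Fin 2)))
    (hBs : Bs = {y ∈ B | (inner ℝ v y : ℝ) ≤ s})
    (hBt : Bt = {y ∈ B | (inner ℝ v y : ℝ) ≤ t}) :
    ∀ x ∈ Bs, ∀ y ∈ Bs, ∀ x' ∈ Bs, ∀ y' ∈ Bs,
      y ∈ connectedComponentIn Bt x → y ∉ connectedComponentIn Bs x →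
      y' ∈ connectedComponentIn Bt x' → y' ∉ connectedComponentIn Bs x' →
      ((x' ∈ connectedComponentIn Bs x ∧ y' ∈ connectedComponentIn Bs y) ∨
       (y' ∈ connectedComponentIn Bs x ∧ x' ∈ connectedComponentIn Bs y)) := by
  have symm_c : ∀ {S : Set (EuclideanSpace ℝ (Fin 2))} {a b},
      b ∈ connectedComponentIn S a → a ∈ connectedComponentIn S b := by
    intro S a b h
    have ha : a ∈ S := by
      by_contra hc
      rw [connectedComponentIn_eq_empty hc] at h
      exact h
    rw [← connectedComponentIn_eq h]
    exact mem_connectedComponentIn ha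
  have trans_c : ∀ {S : Set (EuclideanSpace ℝ (Fin 2))} {a b c},
      b ∈ connectedComponentIn S a → c ∈ connectedComponentIn S b →
      c ∈ connectedComponentIn S a := by
    intro S a b c h h'
    rwa [connectedComponentIn_eq h]
  obtain ⟨pr, hpr⟩ : ∃ k : Fin (n + 3), k + 1 = i := ⟨i - 1, sub_add_cancel i 1⟩
  set E : Fin (n + 3) → Set (EuclideanSpace ℝ (Fin 2)) :=
    fun j => segment ℝ (w j) (w (j + 1)) with hE
  have hmemB : ∀ z, z ∈ B ↔ ∃ j, z ∈ E j := by
    intro z; rw [hB]; simp [hE]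
  have hmemBs : ∀ z, z ∈ Bs ↔ (∃ j, z ∈ E j) ∧ (inner ℝ v z : ℝ) ≤ s := by
    intro z; rw [hBs, ← hmemB]; rfl
  have hmemBt : ∀ z, z ∈ Bt ↔ (∃ j, z ∈ E j) ∧ (inner ℝ v z : ℝ) ≤ t := by
    intro z; rw [hBt, ← hmemB]; rfl
  -- points of the same piece are in the same component
  have hpiece : ∀ j a b, a ∈ E j → b ∈ E j → (inner ℝ v a : ℝ) ≤ s → (inner ℝ v b : ℝ) ≤ s →
      b ∈ connectedComponentIn Bs a := by
    intro j a b ha hb ha' hb'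
    have hpc : IsPreconnected (E j ∩ {y | (inner ℝ v y : ℝ) ≤ s}) :=
      ((convex_segment _ _).inter (half_convex v s)).isPreconnected
    refine hpc.subset_connectedComponentIn (x := a) ⟨ha, ha'⟩ ?_ ⟨hb, hb'⟩
    intro z hz
    exact (hmemBs z).2 ⟨⟨j, hz.1⟩, hz.2⟩
  have hL : ∀ j, w j ∈ E j := fun j => left_mem_segment ℝ _ _
  have hR : ∀ j, w (j + 1) ∈ E j := fun j => right_mem_segment ℝ _ _
  have hwBs : ∀ j, (inner ℝ v (w j) : ℝ) ≤ s → w j ∈ Bs := fun j h =>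
    (hmemBs _).2 ⟨⟨j, hL j⟩, h⟩
  -- the trap
  have trap : ∀ (X : Set (EuclideanSpace ℝ (Fin 2))) (J : Set (Fin (n + 3))),
      (∀ j ∈ J, ∀ z ∈ E j, (inner ℝ v z : ℝ) ≤ s → z ∈ X) →
      (∀ j, ∀ z ∈ E j, (inner ℝ v z : ℝ) ≤ s → z ∈ X → j ∈ J) →
      (∀ j k, j ∈ J → (j = i ∨ j + 1 = i) → (k = i ∨ k + 1 = i) → k ∈ J) →
      ∀ x ∈ Bs, x ∈ X → ∀ y ∈ Bs, y ∈ connectedComponentIn Bt x → y ∈ X := by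
    intro X J h1 h2 h3 x hx hxX y hy hxy
    obtain ⟨⟨j₀, hj₀⟩, hxs⟩ := (hmemBs x).1 hx
    obtain ⟨j, hj, hyj⟩ := comp_trap (K := fun j => E j ∩ {y | (inner ℝ v y : ℝ) ≤ t})
      (fun j => (seg_closed _ _).inter (half_closed v t)) J
      (by
        rintro j hj k hjk ⟨p, ⟨hpj, hpt⟩, ⟨hpk, -⟩⟩
        obtain ⟨m, rfl, hm⟩ := poly_inter_vertex hsimple hjk hpj hpk
        by_cases hmi : m = i
        · subst hmi
          refine h3 j k hj ?_ ?_ <;> tauto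
        · have hms : (inner ℝ v (w m) : ℝ) ≤ s := by
            by_contra! hc
            exact hmi (hother m ⟨hc.le, hpt⟩)
          exact h2 k _ hpk hms (h1 j hj _ hpj hms))
      (S := Bt)
      (by
        intro z hz
        obtain ⟨⟨j, hj⟩, hzt⟩ := (hmemBt z).1 hz
        exact ⟨j, hj, hzt⟩)
      ((hmemBt x).2 ⟨⟨j₀, hj₀⟩, hxs.trans hst⟩) (h2 j₀ x hj₀ hxs hxX)
      ⟨hj₀, hxs.trans hst⟩ hxy
    exact h1 j hj y hyj.1 ((hmemBs y).1 hy).2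
  set D : Set (EuclideanSpace ℝ (Fin 2)) := connectedComponentIn Bs (w pr) ∪
    connectedComponentIn Bs (w (i + 1)) ∪ connectedComponentIn Bs (w i) with hD
  have hDsat : ∀ a b, a ∈ D → b ∈ connectedComponentIn Bs a → b ∈ D := by
    rintro a b ((h | h) | h) hb
    · exact Or.inl (Or.inl (trans_c h hb))
    · exact Or.inl (Or.inr (trans_c h hb))
    · exact Or.inr (trans_c h hb)
  have hDi : ∀ j, (j = i ∨ j + 1 = i) → ∀ z ∈ E j, (inner ℝ v z : ℝ) ≤ s → z ∈ D := by
    rintro j hj z hz hzs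
    rcases hj with rfl | hj
    · rcases seg_low hz hzs with h | h
      · exact Or.inr (hpiece _ _ _ (hL _) hz h hzs)
      · exact Or.inl (Or.inr (hpiece _ _ _ (hR _) hz h hzs))
    · have : j = pr := add_right_cancel (hj.trans hpr.symm)
      subst this
      rcases seg_low hz hzs with h | h
      · exact Or.inl (Or.inl (hpiece _ _ _ (hL _) hz h hzs))
      · refine Or.inr ?_
        rw [← hpr]
        exact hpiece _ _ _ (hR _) hz h hzs
  have claim : ∀ x ∈ Bs, ∀ y ∈ Bs, y ∈ connectedComponentIn Bt x →
      y ∉ connectedComponentIn Bs x → x ∈ D ∧ y ∈ D := by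
    intro x hx y hy hxy hn
    by_cases hxD : x ∈ D
    · refine ⟨hxD, trap D
        {j | (j = i ∨ j + 1 = i) ∨ ∃ z ∈ E j, (inner ℝ v z : ℝ) ≤ s ∧ z ∈ D}
        ?_ ?_ ?_ x hx hxD y hy hxy⟩
      · rintro j (hj | ⟨a, ha, has, haD⟩) z hz hzs
        · exact hDi j hj z hz hzs
        · exact hDsat a z haD (hpiece j a z ha hz has hzs)
      · exact fun j z hz hzs hzD => Or.inr ⟨z, hz, hzs, hzD⟩
      · exact fun j k _ _ hk => Or.inl hk
    · refine absurd (trap (connectedComponentIn Bs x)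
        {j | ∃ z ∈ E j, (inner ℝ v z : ℝ) ≤ s ∧ z ∈ connectedComponentIn Bs x}
        ?_ ?_ ?_ x hx (mem_connectedComponentIn hx) y hy hxy) hn
      · rintro j ⟨a, ha, has, hax⟩ z hz hzs
        exact trans_c hax (hpiece j a z ha hz has hzs)
      · exact fun j z hz hzs hzD => ⟨z, hz, hzs, hzD⟩
      · rintro j k ⟨a, ha, has, hax⟩ hj -
        exact absurd (hDsat a x (hDi j hj a ha has) (symm_c hax)) hxD
  have claim2 : ∀ x ∈ Bs, ∀ y ∈ Bs, y ∈ connectedComponentIn Bt x →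
      y ∉ connectedComponentIn Bs x →
      (x ∈ connectedComponentIn Bs (w pr) ∧ y ∈ connectedComponentIn Bs (w (i + 1))) ∨
      (y ∈ connectedComponentIn Bs (w pr) ∧ x ∈ connectedComponentIn Bs (w (i + 1))) := by
    intro x hx y hy hxy hn
    obtain ⟨hxD, hyD⟩ := claim x hx y hy hxy hn
    have key : ∀ c, x ∈ connectedComponentIn Bs c → y ∈ connectedComponentIn Bs c → False :=
      fun c h h' => hn (trans_c (symm_c h) h')
    have hin : ∀ {c z}, z ∈ connectedComponentIn Bs c → (inner ℝ v c : ℝ) ≤ s := by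
      intro c z h
      exact ((hmemBs c).1 (connectedComponentIn_subset _ _ (symm_c h))).2
    have e1 : ∀ {z z'}, z ∈ connectedComponentIn Bs (w i) → z' ∈ connectedComponentIn Bs (w pr) →
        z ∈ connectedComponentIn Bs (w pr) := by
      intro z z' h h'
      have := hpiece pr (w pr) (w (pr + 1)) (hL _) (hR _) (hin h') (by rw [hpr]; exact hin h)
      rw [hpr] at this
      exact trans_c this h
    have e2 : ∀ {z z'}, z ∈ connectedComponentIn Bs (w i) →
        z' ∈ connectedComponentIn Bs (w (i + 1)) → z ∈ connectedComponentIn Bs (w (i + 1)) := by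
      intro z z' h h'
      exact trans_c (hpiece i (w (i + 1)) (w i) (hR _) (hL _) (hin h') (hin h)) h
    rcases hxD with (h | h) | h <;> rcases hyD with (h' | h') | h'
    · exact (key _ h h').elim
    · exact Or.inl ⟨h, h'⟩
    · exact (key _ h (e1 h' h)).elim
    · exact Or.inr ⟨h', h⟩
    · exact (key _ h h').elim
    · exact (key _ h (e2 h' h)).elim
    · exact (key _ (e1 h h') h').elim
    · exact (key _ (e2 h h') h').elim
    · exact (key _ h h').elim
  intro x hx y hy x' hx' y' hy' h1 h2 h3 h4
  rcases claim2 x hx y hy h1 h2 with ⟨a, b⟩ | ⟨a, b⟩ <;>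
    rcases claim2 x' hx' y' hy' h3 h4 with ⟨c, d⟩ | ⟨c, d⟩
  · exact Or.inl ⟨trans_c (symm_c a) c, trans_c (symm_c b) d⟩
  · exact Or.inr ⟨trans_c (symm_c a) c, trans_c (symm_c b) d⟩
  · exact Or.inr ⟨trans_c (symm_c b) d, trans_c (symm_c a) c⟩
  · exact Or.inl ⟨trans_c (symm_c b) d, trans_c (symm_c a) c⟩
end

section
/- Let a, b, c, d ∈ ℝ² satisfy cross(b − c, a − c) > 0 and cross(b − c, d − c) < 0, i.e. a and d lie strictly on opposite sides of the line through c and b, where cross(u,w) = u₁w₂ − u₂w₁. Then the two triangles convexHull ℝ {c, a, b} and convexHull ℝ {c, b, d} intersect exactly in their common edge: convexHull ℝ {c, a, b} ∩ convexHull ℝ {c, b, d} = segment ℝ c b. -/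
theorem hull_side_aux (a b c x : EuclideanSpace ℝ (Fin 2))
    (hx : x ∈ convexHull ℝ ({a, c, b} : Set (EuclideanSpace ℝ (Fin 2)))) :
    ∃ s : ℝ, 0 ≤ s ∧
      (b - c) 0 * (x - c) 1 - (b - c) 1 * (x - c) 0 =
        s * ((b - c) 0 * (a - c) 1 - (b - c) 1 * (a - c) 0) ∧
      (s = 0 → x ∈ segment ℝ c b) := by
  rw [convexHull_insert (Set.insert_nonempty _ _), convexHull_pair, mem_convexJoin] at hx
  obtain ⟨a', ha', y, hy, s, t, hs, ht, hst, rfl⟩ := hx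
  rw [Set.mem_singleton_iff] at ha'
  subst ha'
  refine ⟨s, hs, ?_, ?_⟩
  · obtain ⟨p, q, hp, hq, hpq, rfl⟩ := hy
    obtain rfl : t = 1 - s := by linarith
    obtain rfl : p = 1 - q := by linarith
    simp only [PiLp.sub_apply, PiLp.add_apply, PiLp.smul_apply, smul_eq_mul]
    ring
  · rintro rfl
    obtain rfl : t = 1 := by linarith
    simpa using hy

/-- If `a` and `d` lie strictly on opposite sides of the line through
`c` and `b` (expressed with the planar cross product `cross(u,w) = u₁w₂ − u₂w₁`),
then the triangles `convexHull ℝ {c, a, b}` and `convexHull ℝ {c, b, d}` intersect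
exactly in their common edge `segment ℝ c b`. -/
theorem triangles_intersect_in_common_edge
    (a b c d : EuclideanSpace ℝ (Fin 2))
    (h1 : (b - c) 0 * (a - c) 1 - (b - c) 1 * (a - c) 0 > 0)
    (h2 : (b - c) 0 * (d - c) 1 - (b - c) 1 * (d - c) 0 < 0) :
    convexHull ℝ ({c, a, b} : Set (EuclideanSpace ℝ (Fin 2))) ∩
      convexHull ℝ ({c, b, d} : Set (EuclideanSpace ℝ (Fin 2))) =
    segment ℝ c b := by
  apply Set.Subset.antisymm
  · rintro x ⟨hx1, hx2⟩
    rw [Set.insert_comm] at hx1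
    rw [Set.pair_comm b d, Set.insert_comm] at hx2
    obtain ⟨s, hs, e1, k⟩ := hull_side_aux a b c x hx1
    obtain ⟨t, ht, e2, -⟩ := hull_side_aux d b c x hx2
    apply k
    by_contra hne
    have hs' : 0 < s := lt_of_le_of_ne hs (Ne.symm hne)
    have := mul_pos hs' h1
    have := mul_nonneg ht (neg_nonneg.mpr h2.le)
    linarith
  · rw [← convexHull_pair]
    refine Set.subset_inter (convexHull_mono ?_) (convexHull_mono ?_) <;>
    · intro z hz
      simp only [Set.mem_insert_iff, Set.mem_singleton_iff] at hz ⊢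
      tauto
end
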